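/- arXiv:1605.09055 — 2 statements merged into one kernel-verified Lean document; each statement's English description precedes it below -/
import Mathlib

section
/- There exists a constant C > 0 such that for every positive integer n, every simple graph G on n vertices with exactly ⌊n²/4⌋ + 1 edges contains at least ((2+√2)/16)·n² − C·n^{15/8} edges that occur in C₅. -/
open SimpleGraph

/-- An edge `e` of `G` occurs in `C_m`: `G` contains a cycle of length `m`
whose edge set contains `e`. -/
def occursInC {V : Type*} (G : SimpleGraph V) (m : ℕ) (e : Sym2 V) : Prop :=
  ∃ (u : V) (w : G.Walk u u), w.IsCycle ∧ w.length = m ∧ e ∈ w.edges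

/-- The number of edges of `G` that occur in a cycle of length `m`. -/
noncomputable def countEdgesInC {V : Type*} (G : SimpleGraph V) (m : ℕ) : ℕ :=
  {e | e ∈ G.edgeSet ∧ occursInC G m e}.ncard

theorem real_ineq (a b i k t : ℝ) (ha : 0 ≤ a) (hb : 0 ≤ b) (hi : 0 ≤ i) (hk : 0 ≤ k)
    (ht : 0 ≤ t) (ht2 : t ^ 2 = 2)
    (h : (a + b + i + k) ^ 2 / 2 < 2 * a * b + 2 * a * i + 2 * i * k + k ^ 2) :
    2 * a * b ≤ (2 - t) / 8 * (a + b + i + k) ^ 2 := by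
  have ht1 : t ≤ 2 := by nlinarith
  obtain ⟨s, hs⟩ : ∃ s, s = a + b + i + k := ⟨_, rfl⟩
  rw [← hs] at h ⊢
  obtain ⟨d, hd⟩ : ∃ d, d = s / 2 - b - i := ⟨_, rfl⟩
  have ha' : a = s / 2 + d - k := by linarith
  have hi' : i = s / 2 - d - b := by linarith
  have hbk : b * k < k ^ 2 / 2 - d ^ 2 := by
    rw [ha', hi'] at h
    nlinarith
  have h2 : k ^ 2 / 2 - d ^ 2 = (2 - t) * k * (k - d) - (d - (1 - t / 2) * k) ^ 2 := by
    have : (d - (1 - t / 2) * k) ^ 2 = d ^ 2 - (2 - t) * k * d + (1 - t + t ^ 2 / 4) * k ^ 2 := by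
      ring
    rw [this, ht2]; ring
  have hk0 : 0 < k := by
    rcases hk.lt_or_eq with h | h
    · exact h
    · subst h; nlinarith [sq_nonneg d]
  have h3 : b ≤ (2 - t) * (k - d) := by
    by_contra hc
    push Not at hc
    nlinarith [sq_nonneg (d - (1 - t / 2) * k)]
  have h4 : a * b ≤ a * ((2 - t) * (k - d)) := mul_le_mul_of_nonneg_left h3 ha
  have h5 : a = s / 2 - (k - d) := by linarith
  have h6 : a * (k - d) ≤ s ^ 2 / 16 := by
    rw [h5]; nlinarith [sq_nonneg (s / 4 - (k - d))]
  have h7 : (2 - t) * (a * (k - d)) ≤ (2 - t) * (s ^ 2 / 16) :=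
    mul_le_mul_of_nonneg_left h6 (by linarith)
  nlinarith

section weighted
open Classical

variable {V : Type*} [Fintype V]

noncomputable def wt (R : V → V → Prop) (p : V → ℝ) : ℝ :=
  ∑ u, ∑ v, if R u v then p u * p v else 0

theorem sum_prod_aux (f g : V → ℝ) : ∑ u, ∑ v, f u * g v = (∑ u, f u) * ∑ v, g v := by
  rw [Finset.sum_mul_sum]

/-- A weighting supported on a bipartite piece. -/
theorem wt_bip (R : V → V → Prop) (p : V → ℝ) (hp : ∀ u, 0 ≤ p u) (P : V → Prop)
    (h : ∀ u v, p u ≠ 0 → p v ≠ 0 → R u v → (P u ↔ ¬ P v)) :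
    wt R p ≤ (∑ u, p u) ^ 2 / 2 := by
  let f : V → ℝ := fun u => if P u then p u else 0
  let g : V → ℝ := fun u => if P u then 0 else p u
  have hfg : ∑ u, p u = ∑ u, f u + ∑ u, g u := by
    rw [← Finset.sum_add_distrib]
    refine Finset.sum_congr rfl fun u _ => ?_
    by_cases hu : P u <;> simp [f, g, hu]
  have hle : wt R p ≤ ∑ u, ∑ v, (f u * g v + g u * f v) := by
    refine Finset.sum_le_sum fun u _ => Finset.sum_le_sum fun v _ => ?_
    have hu0 := hp u
    have hv0 := hp v
    have huv := mul_nonneg hu0 hv0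
    by_cases hR : R u v
    · by_cases h1 : p u = 0
      · simp [f, g, h1]
      by_cases h2 : p v = 0
      · simp [f, g, h2]
      have := h u v h1 h2 hR
      by_cases hu : P u <;> by_cases hv : P v <;> simp_all [f, g]
    · by_cases hu : P u <;> by_cases hv : P v <;> simp_all [f, g]
  have : ∑ u, ∑ v, (f u * g v + g u * f v) = 2 * ((∑ u, f u) * ∑ u, g u) := by
    simp only [Finset.sum_add_distrib, sum_prod_aux]; ring
  rw [hfg]
  nlinarith [sq_nonneg (∑ u, f u - ∑ u, g u)]

theorem wt_line (R : V → V → Prop) (hR : ∀ u v, R u v → R v u) (p d : V → ℝ) (t : ℝ)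
    (hd : ∀ u v, d u ≠ 0 → d v ≠ 0 → ¬ R u v) :
    wt R (fun u => p u + t * d u) =
      wt R p + t * (2 * ∑ u, d u * ∑ v, if R u v then p v else 0) := by
  have h1 : ∑ u, ∑ v, (if R u v then d u * p v else 0) =
      ∑ u, d u * ∑ v, if R u v then p v else 0 := by
    refine Finset.sum_congr rfl fun u _ => ?_
    rw [Finset.mul_sum]
    refine Finset.sum_congr rfl fun v _ => ?_
    split_ifs <;> simp
  have h2 : ∑ u, ∑ v, (if R u v then p u * d v else 0) =
      ∑ u, d u * ∑ v, if R u v then p v else 0 := by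
    rw [← h1, Finset.sum_comm]
    refine Finset.sum_congr rfl fun u _ => Finset.sum_congr rfl fun v _ => ?_
    by_cases h : R u v
    · simp [h, hR _ _ h, mul_comm]
    · have : ¬ R v u := fun h' => h (hR _ _ h')
      simp [h, this]
  have h3 : wt R (fun u => p u + t * d u) = ∑ u, ∑ v,
      ((if R u v then p u * p v else 0) + t * (if R u v then d u * p v else 0)
        + t * (if R u v then p u * d v else 0)) := by
    refine Finset.sum_congr rfl fun u _ => Finset.sum_congr rfl fun v _ => ?_
    by_cases h : R u v
    · have : d u * d v = 0 := by
        by_contra hc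
        exact hd u v (left_ne_zero_of_mul hc) (right_ne_zero_of_mul hc) h
      simp only [h, if_true]
      linear_combination t ^ 2 * this
    · simp [h]
  rw [h3]
  simp only [Finset.sum_add_distrib, ← Finset.mul_sum]
  rw [h1, h2, wt]; ring

theorem move_aux (p d : V → ℝ) (hp : ∀ u, 0 ≤ p u) (hd : ∀ u, d u ≠ 0 → p u ≠ 0)
    (hs : ∑ u, d u = 0) (hne : ∃ u, d u ≠ 0) :
    ∃ t : ℝ, 0 ≤ t ∧ (∀ u, 0 ≤ p u + t * d u) ∧ ∃ w, p w ≠ 0 ∧ p w + t * d w = 0 := by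
  have hneg : ∃ u, d u < 0 := by
    by_contra hc
    push Not at hc
    obtain ⟨u, hu⟩ := hne
    exact hu ((Finset.sum_eq_zero_iff_of_nonneg (fun i _ => hc i)).1 hs u (Finset.mem_univ _))
  obtain ⟨w, hw, hmin⟩ := Finset.exists_min_image (Finset.univ.filter fun u => d u < 0)
    (fun u => p u / (- d u)) (by obtain ⟨u, hu⟩ := hneg; exact ⟨u, by simpa using hu⟩)
  simp only [Finset.mem_filter, Finset.mem_univ, true_and] at hw hmin
  have hw' : 0 < - d w := by linarith
  have ht0 : 0 ≤ p w / (- d w) := div_nonneg (hp w) hw'.le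
  refine ⟨p w / (- d w), ht0, ?_, w, hd w hw.ne, ?_⟩
  · intro u
    by_cases hu : d u < 0
    · have := hmin u hu
      rw [le_div_iff₀ (by linarith)] at this
      linarith
    · have := mul_nonneg ht0 (not_lt.1 hu)
      have := hp u
      linarith
  · have : d w ≠ 0 := hw.ne
    field_simp; ring

theorem dir_aux (D : V → ℝ) (w1 w2 w3 : V) (h12 : w1 ≠ w2) (h13 : w1 ≠ w3) (h23 : w2 ≠ w3) :
    ∃ d : V → ℝ, (∃ u, d u ≠ 0) ∧ (∀ u, d u ≠ 0 → u = w1 ∨ u = w2 ∨ u = w3) ∧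
      ∑ u, d u = 0 ∧ ∑ u, d u * D u = 0 := by
  have key : ∀ x y z : ℝ, x + y + z = 0 → x * D w1 + y * D w2 + z * D w3 = 0 →
      (x ≠ 0 ∨ y ≠ 0 ∨ z ≠ 0) → ∃ d : V → ℝ, (∃ u, d u ≠ 0) ∧
      (∀ u, d u ≠ 0 → u = w1 ∨ u = w2 ∨ u = w3) ∧
      ∑ u, d u = 0 ∧ ∑ u, d u * D u = 0 := by
    intro x y z h1 h2 h3
    refine ⟨fun u => (if u = w1 then x else 0) + (if u = w2 then y else 0)
      + (if u = w3 then z else 0), ?_, ?_, ?_, ?_⟩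
    · rcases h3 with h | h | h
      · exact ⟨w1, by simp [h12, h13, h]⟩
      · exact ⟨w2, by simp [h12.symm, h23, h]⟩
      · exact ⟨w3, by simp [h13.symm, h23.symm, h]⟩
    · intro u hu
      by_contra hc
      push Not at hc
      simp [hc] at hu
    · simp [Finset.sum_add_distrib, h1]
    · simp [add_mul, Finset.sum_add_distrib, ite_mul, h2]
  by_cases h : D w2 = D w3 ∧ D w3 = D w1
  · exact key 1 (-1) 0 (by ring) (by rw [h.1, h.2]; ring) (by simp)
  · refine key (D w2 - D w3) (D w3 - D w1) (D w1 - D w2) (by ring) (by ring) ?_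
    by_contra hc
    push Not at hc
    exact h ⟨by linarith, by linarith⟩

end weighted

section weighted2
open Classical

variable {V : Type*} [Fintype V]

theorem terminal_one (G : SimpleGraph V) (H : V → V → Prop) (hs : ∀ u v, H u v → H v u)
    (hHG : ∀ u v, H u v → G.Adj u v)
    (hC : ∀ u v x w y, H u v → G.Adj u x → G.Adj x w → G.Adj w y → G.Adj y v → False)
    (p : V → ℝ) (hp : ∀ u, 0 ≤ p u) (he : (∑ u, p u) ^ 2 / 2 < wt G.Adj p)
    (hind : ∀ x y z, p x ≠ 0 → p y ≠ 0 → p z ≠ 0 → x ≠ y → x ≠ z → y ≠ z →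
      ¬ G.Adj x y → ¬ G.Adj x z → ¬ G.Adj y z → False)
    (u v : V) (huv : H u v) (hu : p u ≠ 0) (hv : p v ≠ 0)
    (hone : ∀ k, p k ≠ 0 → G.Adj v k → k = u) :
    wt H p ≤ (2 - Real.sqrt 2) / 8 * (∑ u, p u) ^ 2 := by
  have hi : ∀ u v x y, H u v → G.Adj u x → G.Adj u y → G.Adj x y → False := by
    intro u v x y h h1 h2 h3
    exact hC v u u x y (hs _ _ h) (hHG _ _ (hs _ _ h)) h1 h3 h2.symm
  have huvA := hHG _ _ huv
  have hne : u ≠ v := huvA.ne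
  -- the rest is a clique
  have hcl : ∀ k l, p k ≠ 0 → p l ≠ 0 → k ≠ u → k ≠ v → l ≠ u → l ≠ v → k ≠ l → G.Adj k l := by
    intro k l hk hl h1 h2 h3 h4 h5
    by_contra hc
    exact hind v k l hv hk hl h2.symm h4.symm h5 (fun h => h1 (hone k hk h))
      (fun h => h3 (hone l hl h)) hc
  by_cases hA : ∃ k l, p k ≠ 0 ∧ p l ≠ 0 ∧ k ≠ u ∧ k ≠ v ∧ H k l
  · exfalso
    obtain ⟨k, l, hk, hl, hku, hkv, hkl⟩ := hA
    -- the clique has at most two elements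
    have htwo : ∀ x y, p x ≠ 0 → p y ≠ 0 → x ≠ u → x ≠ v → y ≠ u → y ≠ v → x ≠ k → y ≠ k →
        x = y := by
      intro x y hx hy h1 h2 h3 h4 h5 h6
      by_contra hxy
      exact hi k l x y hkl (hcl k x hk hx hku hkv h1 h2 h5.symm)
        (hcl k y hk hy hku hkv h3 h4 h6.symm) (hcl x y hx hy h1 h2 h3 h4 hxy)
    have huniq : ∀ x y, p x ≠ 0 → p y ≠ 0 → x ≠ u → x ≠ v → y ≠ u → y ≠ v → x ≠ y →
        G.Adj u x → G.Adj u y → False := by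
      intro x y hx hy h1 h2 h3 h4 h5 h6 h7
      exact hi u v x y huv h6 h7 (hcl x y hx hy h1 h2 h3 h4 h5)
    by_cases hB : ∃ i, p i ≠ 0 ∧ i ≠ u ∧ i ≠ v ∧ G.Adj u i
    · obtain ⟨i, hip, hiu, hiv, hui⟩ := hB
      refine absurd he (not_lt.2 (wt_bip G.Adj p hp (fun w => G.Adj u w) ?_))
      intro x y hx hy hxy
      constructor
      · intro h1 h2
        exact hi u v x y huv h1 h2 hxy
      · intro h1
        by_contra h2
        by_cases hxu : x = u
        · subst hxu; exact h1 hxy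
        by_cases hyu : y = u
        · subst hyu; exact h2 hxy.symm
        have hxv : x ≠ v := by rintro rfl; exact h2 huvA
        have hyv : y ≠ v := by rintro rfl; exact h1 huvA
        have hxi : x ≠ i := by rintro rfl; exact h2 hui
        have hyi : y ≠ i := by rintro rfl; exact h1 hui
        have hxy' := hxy.ne
        by_cases hik : i = k
        · subst hik
          exact hxy' (htwo x y hx hy hxu hxv hyu hyv hxi hyi)
        · by_cases hxk : x = k
          · have hyk : y ≠ k := by rw [← hxk]; exact hxy'.symm
            exact hyi (htwo y i hy hip hyu hyv hiu hiv hyk hik)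
          · exact hxi (htwo x i hx hip hxu hxv hiu hiv hxk hik)
    · push Not at hB
      refine absurd he (not_lt.2 (wt_bip G.Adj p hp (fun w => w = v ∨ w = k) ?_))
      intro x y hx hy hxy
      have hxy' := hxy.ne
      by_cases hxu : x = u
      · subst hxu
        have hyv : y = v := by
          by_contra hyv
          exact hB y hy hxy'.symm hyv hxy
        subst hyv
        simp [hne, hku.symm]
      by_cases hyu : y = u
      · subst hyu
        have hxv : x = v := by
          by_contra hxv
          exact hB x hx hxy' hxv hxy.symm
        subst hxv
        simp [hne, hku.symm]
      have hxv : x ≠ v := by rintro rfl; exact hyu (hone y hy hxy)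
      have hyv : y ≠ v := by rintro rfl; exact hxu (hone x hx hxy.symm)
      simp only [hxv, hyv, false_or]
      constructor
      · intro h1 h2; exact hxy' (h1.trans h2.symm)
      · intro h1
        by_contra h2
        exact hxy' (htwo x y hx hy hxu hxv hyu hyv h2 h1)
  · push Not at hA
    let fu : V → ℝ := fun w => if w = u then p u else 0
    let fv : V → ℝ := fun w => if w = v then p v else 0
    let fi : V → ℝ := fun w => if w ≠ u ∧ w ≠ v ∧ G.Adj u w then p w else 0
    let fk : V → ℝ := fun w => if w ≠ u ∧ w ≠ v ∧ ¬ G.Adj u w then p w else 0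
    have hfu0 : ∀ w, 0 ≤ fu w := fun w => by simp only [fu]; split_ifs <;> simp [hp]
    have hfv0 : ∀ w, 0 ≤ fv w := fun w => by simp only [fv]; split_ifs <;> simp [hp]
    have hfi0 : ∀ w, 0 ≤ fi w := fun w => by simp only [fi]; split_ifs <;> simp [hp]
    have hfk0 : ∀ w, 0 ≤ fk w := fun w => by simp only [fk]; split_ifs <;> simp [hp]
    have hfu : ∑ w, fu w = p u := by simp [fu]
    have hfv : ∑ w, fv w = p v := by simp [fv]
    have hsum : ∑ w, p w = p u + p v + ∑ w, fi w + ∑ w, fk w := by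
      rw [← hfu, ← hfv]
      simp only [← Finset.sum_add_distrib]
      refine Finset.sum_congr rfl fun w _ => ?_
      by_cases h1 : w = u
      · subst h1; simp [fu, fv, fi, fk, hne]
      by_cases h2 : w = v
      · subst h2; simp [fu, fv, fi, fk, hne.symm]
      by_cases h3 : G.Adj u w <;> simp [fu, fv, fi, fk, h1, h2, h3]
    have hE : wt G.Adj p ≤ ∑ w, ∑ z, (fu w * fv z + fv w * fu z + fu w * fi z + fi w * fu z
        + fi w * fk z + fk w * fi z + fk w * fk z) := by
      refine Finset.sum_le_sum fun w _ => Finset.sum_le_sum fun z _ => ?_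
      have e1 := mul_nonneg (hfu0 w) (hfv0 z)
      have e2 := mul_nonneg (hfv0 w) (hfu0 z)
      have e3 := mul_nonneg (hfu0 w) (hfi0 z)
      have e4 := mul_nonneg (hfi0 w) (hfu0 z)
      have e5 := mul_nonneg (hfi0 w) (hfk0 z)
      have e6 := mul_nonneg (hfk0 w) (hfi0 z)
      have e7 := mul_nonneg (hfk0 w) (hfk0 z)
      split_ifs with hwz
      swap
      · linarith
      by_cases hw0 : p w = 0
      · rw [hw0]; linarith
      by_cases hz0 : p z = 0
      · rw [hz0]; linarith
      have hwz' := hwz.ne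
      by_cases h1 : w = u
      · by_cases h2 : z = v
        · have : fu w * fv z = p w * p z := by simp [fu, fv, h1, h2]
          linarith
        · have : fu w * fi z = p w * p z := by
            have h3 : z ≠ u := by rw [← h1]; exact hwz'.symm
            have h4 : G.Adj u z := by rw [← h1]; exact hwz
            simp only [fu, fi, if_true, if_pos (And.intro h3 (And.intro h2 h4)), h1]
          linarith
      by_cases h1' : z = u
      · by_cases h2 : w = v
        · have : fv w * fu z = p w * p z := by simp [fu, fv, h1', h2]
          linarith
        · have : fi w * fu z = p w * p z := by
            have h4 : G.Adj u w := by rw [← h1']; exact hwz.symm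
            simp only [fu, fi, if_true, if_pos (And.intro h1 (And.intro h2 h4)), h1']
          linarith
      have h2 : w ≠ v := by rintro rfl; exact h1' (hone z hz0 hwz)
      have h2' : z ≠ v := by rintro rfl; exact h1 (hone w hw0 hwz.symm)
      by_cases h3 : G.Adj u w
      · have h3' : ¬ G.Adj u z := fun h => hi u v w z huv h3 h hwz
        have : fi w * fk z = p w * p z := by
          simp only [fk, fi, if_pos (And.intro h1 (And.intro h2 h3)),
            if_pos (And.intro h1' (And.intro h2' h3'))]
        linarith
      · by_cases h3' : G.Adj u z
        · have : fk w * fi z = p w * p z := by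
            simp only [fk, fi, if_pos (And.intro h1 (And.intro h2 h3)),
              if_pos (And.intro h1' (And.intro h2' h3'))]
          linarith
        · have : fk w * fk z = p w * p z := by
            simp only [fk, if_pos (And.intro h1 (And.intro h2 h3)),
              if_pos (And.intro h1' (And.intro h2' h3'))]
          linarith
    simp only [Finset.sum_add_distrib, sum_prod_aux, hfu, hfv] at hE
    have hB : wt H p ≤ ∑ w, ∑ z, (fu w * fv z + fv w * fu z) := by
      refine Finset.sum_le_sum fun w _ => Finset.sum_le_sum fun z _ => ?_
      have e1 := mul_nonneg (hfu0 w) (hfv0 z)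
      have e2 := mul_nonneg (hfv0 w) (hfu0 z)
      split_ifs with hwz
      swap
      · linarith
      by_cases hw0 : p w = 0
      · rw [hw0]; linarith
      by_cases hz0 : p z = 0
      · rw [hz0]; linarith
      have hwz' := (hHG _ _ hwz).ne
      have a1 : w = u ∨ w = v := by
        by_contra hc
        push Not at hc
        exact hA w z hw0 hz0 hc.1 hc.2 hwz
      have a2 : z = u ∨ z = v := by
        by_contra hc
        push Not at hc
        exact hA z w hz0 hw0 hc.1 hc.2 (hs _ _ hwz)
      rcases a1 with rfl | rfl <;> rcases a2 with rfl | rfl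
      · exact absurd rfl hwz'
      · have : fu w * fv z = p w * p z := by simp [fu, fv]
        linarith
      · have : fv w * fu z = p w * p z := by simp [fu, fv]
        linarith
      · exact absurd rfl hwz'
    simp only [Finset.sum_add_distrib, sum_prod_aux, hfu, hfv] at hB
    have hI : 0 ≤ ∑ w, fi w := Finset.sum_nonneg fun w _ => hfi0 w
    have hK : 0 ≤ ∑ w, fk w := Finset.sum_nonneg fun w _ => hfk0 w
    have := real_ineq (p u) (p v) (∑ w, fi w) (∑ w, fk w) (Real.sqrt 2) (hp u) (hp v) hI hK
      (Real.sqrt_nonneg _) (Real.sq_sqrt (by norm_num)) (by rw [← hsum]; linarith)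
    rw [hsum]
    linarith

theorem terminal (G : SimpleGraph V) (H : V → V → Prop) (hs : ∀ u v, H u v → H v u)
    (hHG : ∀ u v, H u v → G.Adj u v)
    (hC : ∀ u v x w y, H u v → G.Adj u x → G.Adj x w → G.Adj w y → G.Adj y v → False)
    (p : V → ℝ) (hp : ∀ u, 0 ≤ p u) (he : (∑ u, p u) ^ 2 / 2 < wt G.Adj p)
    (hind : ∀ x y z, p x ≠ 0 → p y ≠ 0 → p z ≠ 0 → x ≠ y → x ≠ z → y ≠ z →
      ¬ G.Adj x y → ¬ G.Adj x z → ¬ G.Adj y z → False) :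
    wt H p ≤ (2 - Real.sqrt 2) / 8 * (∑ u, p u) ^ 2 := by
  have hi : ∀ u v x y, H u v → G.Adj u x → G.Adj u y → G.Adj x y → False := by
    intro u v x y h h1 h2 h3
    exact hC v u u x y (hs _ _ h) (hHG _ _ (hs _ _ h)) h1 h3 h2.symm
  by_cases hbl : ∃ u v, p u ≠ 0 ∧ p v ≠ 0 ∧ H u v
  swap
  · push Not at hbl
    have : wt H p = 0 := by
      refine Finset.sum_eq_zero fun u _ => Finset.sum_eq_zero fun v _ => ?_
      split_ifs with h
      · by_contra hc
        exact hbl u v (left_ne_zero_of_mul hc) (right_ne_zero_of_mul hc) h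
      · rfl
    rw [this]
    have h2 : Real.sqrt 2 ≤ 2 := by
      rw [Real.sqrt_le_left (by norm_num)]; norm_num
    have : 0 ≤ (2 - Real.sqrt 2) / 8 := by linarith
    positivity
  obtain ⟨u, v, hu, hv, huv⟩ := hbl
  have huvA := hHG _ _ huv
  by_cases h1 : ∀ k, p k ≠ 0 → G.Adj v k → k = u
  · exact terminal_one G H hs hHG hC p hp he hind u v huv hu hv h1
  by_cases h2 : ∀ k, p k ≠ 0 → G.Adj u k → k = v
  · exact terminal_one G H hs hHG hC p hp he hind v u (hs _ _ huv) hv hu h2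
  exfalso
  push Not at h1 h2
  obtain ⟨u', hu', hvu', hu'u⟩ := h1
  obtain ⟨v', hv', huv', hv'v⟩ := h2
  have huu' : ¬ G.Adj u u' := fun h => hi u v u' v huv h huvA hvu'.symm
  have hvv' : ¬ G.Adj v v' := fun h => hi v u u v' (hs _ _ huv) huvA.symm h huv'
  have hU : ∀ k, p k ≠ 0 → k = u ∨ k = v ∨ k = u' ∨ k = v' := by
    intro k hk
    by_contra hc
    push Not at hc
    obtain ⟨hku, hkv, hku', hkv'⟩ := hc
    have a1 : ¬ G.Adj u k := fun h => hind v v' k hv hv' hk hv'v.symm hkv.symm hkv'.symm hvv'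
      (fun h' => hi u v v k huv huvA h h') (fun h' => hi u v v' k huv huv' h h')
    have a2 : ¬ G.Adj v k := fun h => hind u u' k hu hu' hk hu'u.symm hku.symm hku'.symm huu'
      (fun h' => hi v u u k (hs _ _ huv) huvA.symm h h')
      (fun h' => hi v u u' k (hs _ _ huv) hvu' h h')
    have a3 : G.Adj u' k := by
      by_contra hc
      exact hind u u' k hu hu' hk hu'u.symm hku.symm hku'.symm huu' a1 hc
    have a4 : G.Adj v' k := by
      by_contra hc
      exact hind v v' k hv hv' hk hv'v.symm hkv.symm hkv'.symm hvv' a2 hc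
    exact hC u v v' k u' huv huv' a4 a3.symm hvu'.symm
  refine absurd he (not_lt.2 (wt_bip G.Adj p hp (fun w => w = u ∨ w = u') ?_))
  have n1 : v ≠ u := huvA.ne.symm
  have n2 : v ≠ u' := hvu'.ne
  have n3 : v' ≠ u := huv'.ne.symm
  have n4 : v' ≠ u' := by rintro rfl; exact huu' huv'
  intro x y hx hy hxy
  have b1 : ¬ G.Adj u' u := fun h => huu' h.symm
  have b2 : ¬ G.Adj v' v := fun h => hvv' h.symm
  rcases hU x hx with rfl | rfl | rfl | rfl <;> rcases hU y hy with rfl | rfl | rfl | rfl <;>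
    first
    | exact absurd rfl hxy.ne
    | exact absurd hxy huu'
    | exact absurd hxy hvv'
    | exact absurd hxy b1
    | exact absurd hxy b2
    | simp [n1, n2, n3, n4]

theorem weighted_main (G : SimpleGraph V) (H : V → V → Prop) (hs : ∀ u v, H u v → H v u)
    (hHG : ∀ u v, H u v → G.Adj u v)
    (hC : ∀ u v x w y, H u v → G.Adj u x → G.Adj x w → G.Adj w y → G.Adj y v → False) :
    ∀ (m : ℕ) (p : V → ℝ), (Finset.univ.filter fun u => p u ≠ 0).card = m →
      (∀ u, 0 ≤ p u) → (∑ u, p u) ^ 2 / 2 < wt G.Adj p →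
    wt H p ≤ (2 - Real.sqrt 2) / 8 * (∑ u, p u) ^ 2 := by
  intro m
  induction m using Nat.strong_induction_on with
  | _ m ih =>
  intro p hm hp he
  by_cases hind : ∀ x y z, p x ≠ 0 → p y ≠ 0 → p z ≠ 0 → x ≠ y → x ≠ z → y ≠ z →
      ¬ G.Adj x y → ¬ G.Adj x z → ¬ G.Adj y z → False
  · exact terminal G H hs hHG hC p hp he hind
  push Not at hind
  obtain ⟨w1, w2, w3, p1, p2, p3, n12, n13, n23, a12, a13, a23, -⟩ := hind
  obtain ⟨d, hd0, hdsupp, hdsum, hdD⟩ :=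
    dir_aux (fun u => ∑ v, if G.Adj u v then p v else 0) w1 w2 w3 n12 n13 n23
  -- choose the sign
  have hsign : ∃ d : V → ℝ, (∃ u, d u ≠ 0) ∧ (∀ u, d u ≠ 0 → u = w1 ∨ u = w2 ∨ u = w3) ∧
      ∑ u, d u = 0 ∧ (∑ u, d u * ∑ v, if G.Adj u v then p v else 0) = 0 ∧
      0 ≤ ∑ u, d u * ∑ v, if H u v then p v else 0 := by
    rcases le_total 0 (∑ u, d u * ∑ v, if H u v then p v else 0) with h | h
    · exact ⟨d, hd0, hdsupp, hdsum, hdD, h⟩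
    · refine ⟨fun u => - d u, ?_, ?_, ?_, ?_, ?_⟩
      · simpa using hd0
      · simpa using hdsupp
      · simpa using hdsum
      · simpa only [neg_mul, Finset.sum_neg_distrib, neg_eq_zero] using hdD
      · simpa only [neg_mul, Finset.sum_neg_distrib, Left.nonneg_neg_iff] using h
  clear hd0 hdsupp hdsum hdD d
  obtain ⟨d, hd0, hdsupp, hdsum, hdD, hdB⟩ := hsign
  have hdp : ∀ u, d u ≠ 0 → p u ≠ 0 := by
    intro u hu
    rcases hdsupp u hu with rfl | rfl | rfl <;> assumption
  have hdind : ∀ u v, d u ≠ 0 → d v ≠ 0 → ¬ G.Adj u v := by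
    intro u v hu hv
    have b1 : ¬ G.Adj w2 w1 := fun h => a12 h.symm
    have b2 : ¬ G.Adj w3 w1 := fun h => a13 h.symm
    have b3 : ¬ G.Adj w3 w2 := fun h => a23 h.symm
    rcases hdsupp u hu with rfl | rfl | rfl <;> rcases hdsupp v hv with rfl | rfl | rfl <;>
      first
      | assumption
      | exact G.irrefl
  obtain ⟨t, ht, hnn, w, hw, hw0⟩ := move_aux p d hp hdp hdsum hd0
  have hcard : (Finset.univ.filter fun u => p u + t * d u ≠ 0).card < m := by
    rw [← hm]
    refine Finset.card_lt_card ?_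
    rw [Finset.ssubset_iff_of_subset]
    · exact ⟨w, by simpa using hw, by simpa using hw0⟩
    · intro u hu
      simp only [Finset.mem_filter, Finset.mem_univ, true_and] at hu ⊢
      by_cases h : d u = 0
      · simpa [h] using hu
      · exact hdp u h
  have hsum' : ∑ u, (p u + t * d u) = ∑ u, p u := by
    rw [Finset.sum_add_distrib, ← Finset.mul_sum, hdsum]; ring
  have hE : wt G.Adj (fun u => p u + t * d u) = wt G.Adj p := by
    rw [wt_line G.Adj (fun _ _ h => h.symm) p d t hdind, hdD]; ring
  have hB : wt H p ≤ wt H (fun u => p u + t * d u) := by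
    rw [wt_line H hs p d t (fun u v hu hv h => hdind u v hu hv (hHG _ _ h))]
    nlinarith [mul_nonneg ht hdB]
  have := ih _ hcard (fun u => p u + t * d u) rfl hnn (by rw [hsum', hE]; exact he)
  rw [hsum'] at this
  linarith

end weighted2

section counting
open Classical

variable {V : Type*} [Fintype V]

noncomputable def cnt (R : V → V → Prop) : ℝ := ∑ u, ∑ v, if R u v then (1 : ℝ) else 0

theorem cnt_mono {R S : V → V → Prop} (h : ∀ u v, R u v → S u v) : cnt R ≤ cnt S := by
  refine Finset.sum_le_sum fun u _ => Finset.sum_le_sum fun v _ => ?_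
  by_cases hR : R u v
  · simp [hR, h u v hR]
  · simp only [hR, if_false]; split_ifs <;> simp

theorem cnt_or {R S T : V → V → Prop} (h : ∀ u v, R u v → S u v ∨ T u v) :
    cnt R ≤ cnt S + cnt T := by
  unfold cnt
  simp only [← Finset.sum_add_distrib]
  refine Finset.sum_le_sum fun u _ => Finset.sum_le_sum fun v _ => ?_
  by_cases hR : R u v
  · rcases h u v hR with h | h <;> simp [hR, h] <;> split_ifs <;> simp
  · simp only [hR, if_false]; split_ifs <;> simp

theorem cnt_swap (R : V → V → Prop) : cnt (fun u v => R v u) = cnt R := Finset.sum_comm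

theorem cnt_row (R : V → V → Prop) (W : Finset V) (h : ∀ u v, R u v → u ∈ W) :
    cnt R ≤ W.card * Fintype.card V := by
  have : cnt R ≤ ∑ u, ∑ _v : V, if u ∈ W then (1 : ℝ) else 0 := by
    refine Finset.sum_le_sum fun u _ => Finset.sum_le_sum fun v _ => ?_
    by_cases hR : R u v
    · simp [hR, h u v hR]
    · simp only [hR, if_false]; split_ifs <;> simp
  refine this.trans (le_of_eq ?_)
  simp [mul_comm]

theorem cnt_touch (R : V → V → Prop) (W : Finset V) (h : ∀ u v, R u v → u ∈ W ∨ v ∈ W) :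
    cnt R ≤ 2 * W.card * Fintype.card V := by
  have h1 : cnt R ≤ cnt (fun u _ => u ∈ W) + cnt (fun _ v => v ∈ W) := cnt_or h
  have h2 : cnt (fun (u : V) (_ : V) => u ∈ W) ≤ _ := cnt_row _ W (fun _ _ h => h)
  have h3 : cnt (fun (_ : V) (v : V) => v ∈ W) = cnt (fun (u : V) (_ : V) => u ∈ W) :=
    cnt_swap (fun (u : V) (_ : V) => u ∈ W)
  linarith

theorem cnt_le_sq (R : V → V → Prop) : cnt R ≤ (Fintype.card V : ℝ) ^ 2 := by
  have := cnt_row R Finset.univ (fun u _ _ => Finset.mem_univ u)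
  simpa [sq] using this

theorem sum_ite_le_one (P : V → Prop) [DecidablePred P] (h : ∀ x y, P x → P y → x = y) :
    (∑ x, if P x then (1 : ℝ) else 0) ≤ 1 := by
  by_cases hx : ∃ x, P x
  · obtain ⟨x, hx⟩ := hx
    have : (∑ y, if P y then (1 : ℝ) else 0) ≤ ∑ y, if y = x then (1 : ℝ) else 0 := by
      refine Finset.sum_le_sum fun y _ => ?_
      by_cases hy : P y
      · simp [h y x hy hx, hx]
      · simp only [hy, if_false]; split_ifs <;> simp
    simpa using this
  · push Not at hx
    simp [hx]

def Blu (G : SimpleGraph V) (u v : V) : Prop :=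
  G.Adj u v ∧ ∀ x w y, G.Adj u x → G.Adj x w → G.Adj w y → G.Adj y v →
    x ≠ v → w ≠ u → w ≠ v → y ≠ u → x ≠ y → False

def Tri (G : SimpleGraph V) (u x : V) : Prop := G.Adj u x ∧ ∃ y, G.Adj u y ∧ G.Adj x y

theorem Blu.symm {G : SimpleGraph V} {u v : V} (h : Blu G u v) : Blu G v u :=
  ⟨h.1.symm, fun x w y h1 h2 h3 h4 n1 n2 n3 n4 n5 =>
    h.2 y w x h4.symm h3.symm h2.symm h1.symm n4 n3 n2 n1 n5.symm⟩

theorem Tri.symm {G : SimpleGraph V} {u v : V} (h : Tri G u v) : Tri G v u := by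
  obtain ⟨h1, y, h2, h3⟩ := h
  exact ⟨h1.symm, y, h3, h2⟩

theorem exists_avoid (s : Finset V) (h : 3 ≤ s.card) (x y : V) : ∃ b ∈ s, b ≠ x ∧ b ≠ y := by
  by_contra hc
  push Not at hc
  have : s ⊆ {x, y} := by
    intro b hb
    have := hc b hb
    by_cases h : b = x
    · simp [h]
    · simp [this h]
  have := (Finset.card_le_card this).trans Finset.card_le_two
  omega

theorem tri_bound (G : SimpleGraph V) (q : ℝ) (hq : 1 ≤ q) (hn : (Fintype.card V : ℝ) = q ^ 4) :
    cnt (fun u v => Blu G u v ∧ Tri G u v) ≤ 4 * q ^ 6 := by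
  obtain ⟨R, hR⟩ : ∃ R : V → V → Prop, R = fun u v => Blu G u v ∧ Tri G u v := ⟨_, rfl⟩
  have hRd : ∀ u v, R u v ↔ Blu G u v ∧ Tri G u v := by intro u v; rw [hR]
  rw [← hR]
  obtain ⟨heavy, hhv⟩ : ∃ heavy : V → V → Prop, ∀ a a', heavy a a' ↔
    (a ≠ a' ∧ 3 ≤ (Finset.univ.filter fun b => R b a ∧ R b a').card) := ⟨_, fun _ _ => Iff.rfl⟩
  have hav : ∀ a a' x y, heavy a a' → ∃ b, R b a ∧ R b a' ∧ b ≠ x ∧ b ≠ y := by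
    intro a a' x y h
    obtain ⟨b, hb, h1, h2⟩ := exists_avoid _ ((hhv _ _).1 h).2 x y
    simp only [Finset.mem_filter, Finset.mem_univ, true_and] at hb
    exact ⟨b, hb.1, hb.2, h1, h2⟩
  have c1 : ∀ a a', heavy a a' → G.Adj a a' := by
    intro a a' h
    obtain ⟨b, hb, hb', -, -⟩ := hav a a' a a h
    obtain ⟨hba, c, hbc, hac⟩ := ((hRd _ _).1 hb).2
    by_cases hca : c = a'
    · rw [← hca]; exact hac
    obtain ⟨b2, h2, h2', n1, n2⟩ := hav a a' b c h
    exact (((hRd _ _).1 h2).1.2 a' b c ((hRd _ _).1 h2').1.1 ((hRd _ _).1 hb').1.1.symm hbc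
      hac.symm ((hhv _ _).1 h).1.symm n1.symm hba.ne n2.symm (fun h => hca h.symm)).elim
  have c2 : ∀ b a a' a'', R b a → R b a' → R b a'' → heavy a a' → heavy a a'' → a' = a'' := by
    intro b a a' a'' h h' h'' hh hh'
    by_contra hc
    obtain ⟨b1, h1, h1', n1, n2⟩ := hav a a' b a'' hh
    exact ((hRd _ _).1 h').1.2 a'' a b1 ((hRd _ _).1 h'').1.1 (c1 _ _ hh').symm
      ((hRd _ _).1 h1).1.1.symm ((hRd _ _).1 h1').1.1 (fun h => hc h.symm)
      ((hRd _ _).1 h).1.1.ne.symm ((hhv _ _).1 hh).1 n1 n2.symm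
  let d : V → ℝ := fun b => ∑ a, if R b a then (1 : ℝ) else 0
  have hD : cnt R = ∑ b, d b := rfl
  have hsq : ∑ b, d b ^ 2 = ∑ b, ∑ a, ∑ a', if R b a ∧ R b a' then (1 : ℝ) else 0 := by
    refine Finset.sum_congr rfl fun b _ => ?_
    rw [sq, Finset.sum_mul_sum]
    refine Finset.sum_congr rfl fun a _ => Finset.sum_congr rfl fun a' _ => ?_
    by_cases h1 : R b a <;> by_cases h2 : R b a' <;> simp [h1, h2]
  have hle : ∑ b, d b ^ 2 ≤ ∑ b, ∑ a, ∑ a', ((if R b a ∧ a = a' then (1 : ℝ) else 0)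
      + (if R b a ∧ R b a' ∧ heavy a a' then (1 : ℝ) else 0)
      + (if R b a ∧ R b a' ∧ a ≠ a' ∧ ¬ heavy a a' then (1 : ℝ) else 0)) := by
    rw [hsq]
    refine Finset.sum_le_sum fun b _ => Finset.sum_le_sum fun a _ =>
      Finset.sum_le_sum fun a' _ => ?_
    by_cases h1 : R b a
    swap
    · simp [h1]
    by_cases h2 : R b a'
    swap
    · simp [h1, h2]
      split_ifs <;> simp
    by_cases h3 : a = a'
    · subst h3; simp [h1]; split_ifs <;> simp
    by_cases h4 : heavy a a' <;> simp [h1, h2, h3, h4]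
  simp only [Finset.sum_add_distrib] at hle
  have s1 : ∑ b, ∑ a, ∑ a', (if R b a ∧ a = a' then (1 : ℝ) else 0) = cnt R := by
    refine Finset.sum_congr rfl fun b _ => Finset.sum_congr rfl fun a _ => ?_
    by_cases h : R b a <;> simp [h]
  have s2 : ∑ b, ∑ a, ∑ a', (if R b a ∧ R b a' ∧ heavy a a' then (1 : ℝ) else 0) ≤ cnt R := by
    refine Finset.sum_le_sum fun b _ => Finset.sum_le_sum fun a _ => ?_
    by_cases h : R b a
    · simp only [h, if_true, true_and]
      exact sum_ite_le_one (fun a' => R b a' ∧ heavy a a') fun x y hx hy => c2 b a x y h hx.1 hy.1 hx.2 hy.2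
    · simp [h]
  have s3 : ∑ b, ∑ a, ∑ a', (if R b a ∧ R b a' ∧ a ≠ a' ∧ ¬ heavy a a' then (1 : ℝ) else 0)
      ≤ 2 * (Fintype.card V : ℝ) ^ 2 := by
    rw [Finset.sum_comm]
    have : ∀ a : V, ∑ b, ∑ a', (if R b a ∧ R b a' ∧ a ≠ a' ∧ ¬ heavy a a' then (1 : ℝ) else 0)
        ≤ ∑ _a' : V, 2 := by
      intro a
      rw [Finset.sum_comm]
      refine Finset.sum_le_sum fun a' _ => ?_
      by_cases h : a ≠ a' ∧ ¬ heavy a a'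
      · have h2 : ¬ 3 ≤ (Finset.univ.filter fun b => R b a ∧ R b a').card :=
          fun h3 => h.2 ((hhv _ _).2 ⟨h.1, h3⟩)
        have h4 : ∑ b, (if R b a ∧ R b a' ∧ a ≠ a' ∧ ¬ heavy a a' then (1 : ℝ) else 0)
            = ((Finset.univ.filter fun b => R b a ∧ R b a').card : ℝ) := by
          rw [Finset.card_filter]
          push_cast
          refine Finset.sum_congr rfl fun b _ => ?_
          simp [h]
        rw [h4]
        have : (Finset.univ.filter fun b => R b a ∧ R b a').card ≤ 2 := by omega
        exact_mod_cast this
      · have : ∀ b, ¬ (R b a ∧ R b a' ∧ a ≠ a' ∧ ¬ heavy a a') := fun b hb => h hb.2.2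
        simp [this]
    refine (Finset.sum_le_sum fun a _ => this a).trans (le_of_eq ?_)
    simp; ring
  have hcs : (∑ b, d b) ^ 2 ≤ (Fintype.card V : ℝ) * ∑ b, d b ^ 2 := by
    have := sq_sum_le_card_mul_sum_sq (s := Finset.univ) (f := d)
    simpa using this
  rw [← hD, hn] at hcs
  rw [s1] at hle
  rw [hn] at s3
  have hfin : cnt R ^ 2 ≤ q ^ 4 * (2 * cnt R + 2 * (q ^ 4) ^ 2) := by
    refine hcs.trans (mul_le_mul_of_nonneg_left ?_ (by positivity))
    linarith
  by_contra hc
  push Not at hc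
  have hq6 : q ^ 4 ≤ q ^ 6 := pow_le_pow_right₀ hq (by norm_num)
  have hq0 : 0 < q ^ 6 := by positivity
  have : (q ^ 4) * (q ^ 4) ^ 2 = q ^ 6 * q ^ 6 := by ring
  nlinarith

theorem cleaning (G : SimpleGraph V) (q : ℝ) (hq : 1 ≤ q) (hn : (Fintype.card V : ℝ) = q ^ 4) :
    ∃ (G' : SimpleGraph V) (H : V → V → Prop), (∀ u v, H u v → H v u) ∧
      (∀ u v, H u v → G'.Adj u v) ∧
      (∀ u v x w y, H u v → G'.Adj u x → G'.Adj x w → G'.Adj w y → G'.Adj y v → False) ∧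
      (∀ u v, H u v → Blu G u v ∧ ¬ Tri G u v ∧
        ((Finset.univ.filter fun x => Tri G u x).card : ℝ) ≤ q ^ 2) ∧
      cnt (Blu G) ≤ cnt H + 6 * q ^ 6 ∧
      cnt (fun u v => G.Adj u v ∧ ¬ G'.Adj u v) ≤ 2 * q ^ 6 := by
  have hq0 : 0 < q := by linarith
  let τ : V → ℝ := fun u => ((Finset.univ.filter fun x => Tri G u x).card : ℝ)
  have hτ : ∀ u, τ u = ∑ x, if Tri G u x then (1 : ℝ) else 0 := by
    intro u; simp [τ]
  let H1 : V → V → Prop := fun u v => Blu G u v ∧ ¬ Tri G u v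
  have H1s : ∀ u v, H1 u v → H1 v u := fun u v h => ⟨h.1.symm, fun h' => h.2 h'.symm⟩
  let H : V → V → Prop := fun u v => H1 u v ∧ τ u ≤ q ^ 2 ∧ τ v ≤ q ^ 2
  let Sat : V → Prop := fun u => ∃ v, H u v
  have Hs : ∀ u v, H u v → H v u := fun u v h => ⟨H1s _ _ h.1, h.2.2, h.2.1⟩
  let G' : SimpleGraph V :=
    { Adj := fun x y => G.Adj x y ∧ ¬ (Sat x ∧ Tri G x y) ∧ ¬ (Sat y ∧ Tri G y x)
      symm := ⟨fun x y h => ⟨h.1.symm, h.2.2, h.2.1⟩⟩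
      loopless := ⟨fun x h => G.irrefl h.1⟩ }
  have noTri : ∀ u v x y, H u v → G'.Adj u x → G'.Adj u y → G'.Adj x y → False := by
    intro u v x y h h1 h2 h3
    exact h1.2.1 ⟨⟨v, h⟩, h1.1, y, h2.1, h3.1⟩
  have hHG : ∀ u v, H u v → G'.Adj u v := by
    intro u v h
    exact ⟨h.1.1.1, fun h' => h.1.2 h'.2, fun h' => h.1.2 h'.2.symm⟩
  refine ⟨G', H, Hs, hHG, ?_, ?_, ?_, ?_⟩
  · intro u v x w y h h1 h2 h3 h4
    have huv := hHG _ _ h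
    refine h.1.1.2 x w y h1.1 h2.1 h3.1 h4.1 ?_ ?_ ?_ ?_ ?_
    · rintro rfl; exact noTri x u w y (Hs _ _ h) h2 h4.symm h3
    · rintro rfl; exact noTri w v y v h h3 huv h4
    · rintro rfl; exact noTri u w x w h h1 huv h2
    · rintro rfl; exact noTri y v x w h h1 h3.symm h2
    · rintro rfl; exact noTri u v x v h h1 huv h4
  · intro u v h
    exact ⟨h.1.1, h.1.2, h.2.1⟩
  · -- lost blue edges
    have t1 := tri_bound G q hq hn
    have key : ∑ u, ∑ v, ∑ x, (if H1 u v ∧ Tri G u x then (1 : ℝ) else 0) ≤ q ^ 8 := by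
      have e : ∑ u, ∑ v, ∑ x, (if H1 u v ∧ Tri G u x then (1 : ℝ) else 0)
          = ∑ v, ∑ x, ∑ u, (if H1 u v ∧ Tri G u x then (1 : ℝ) else 0) := by
        rw [Finset.sum_comm]
        exact Finset.sum_congr rfl fun v _ => Finset.sum_comm
      rw [e]
      have : ∀ v x : V, ∑ u, (if H1 u v ∧ Tri G u x then (1 : ℝ) else 0) ≤ 1 := by
        intro v x
        refine sum_ite_le_one (fun u => H1 u v ∧ Tri G u x) ?_
        rintro u u' ⟨h1, h2⟩ ⟨h1', h2'⟩
        by_contra hc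
        obtain ⟨hux, x', hux', hxx'⟩ := h2
        refine h1.1.2 x' x u' hux' hxx'.symm h2'.1.symm h1'.1.1 ?_ hux.ne.symm ?_
          (fun h => hc h.symm) ?_
        · rintro rfl; exact h1.2 ⟨h1.1.1, x, hux, hxx'.symm⟩
        · rintro rfl; exact h1.2 ⟨hux, x', hux', hxx'⟩
        · rintro rfl; exact h1.2 ⟨h1.1.1, x', hux', h1'.1.1.symm⟩
      calc _ ≤ ∑ _v : V, ∑ _x : V, (1 : ℝ) :=
            Finset.sum_le_sum fun v _ => Finset.sum_le_sum fun x _ => this v x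
        _ = (Fintype.card V : ℝ) * Fintype.card V := by simp
        _ = q ^ 8 := by rw [hn]; ring
    have lost : cnt (fun u v => H1 u v ∧ q ^ 2 < τ u) ≤ q ^ 6 := by
      have : q ^ 2 * cnt (fun u v => H1 u v ∧ q ^ 2 < τ u) ≤
          ∑ u, ∑ v, ∑ x, (if H1 u v ∧ Tri G u x then (1 : ℝ) else 0) := by
        unfold cnt
        rw [Finset.mul_sum]
        refine Finset.sum_le_sum fun u _ => ?_
        rw [Finset.mul_sum]
        refine Finset.sum_le_sum fun v _ => ?_
        by_cases h1 : H1 u v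
        · simp only [h1, true_and, ← hτ]
          split_ifs with h2
          · linarith
          · simp [τ]
        · simp [h1]
      have h8 : q ^ 8 = q ^ 2 * q ^ 6 := by ring
      rw [h8] at key
      exact le_of_mul_le_mul_left (this.trans key) (by positivity)
    have lost' : cnt (fun u v => H1 u v ∧ q ^ 2 < τ v) ≤ q ^ 6 := by
      refine le_trans ?_ lost
      rw [← cnt_swap]
      exact cnt_mono fun u v h => ⟨H1s _ _ h.1, h.2⟩
    have b1 : cnt (Blu G) ≤ cnt (fun u v => Blu G u v ∧ Tri G u v) + cnt H1 := by
      refine cnt_or fun u v h => ?_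
      by_cases h2 : Tri G u v
      · exact Or.inl ⟨h, h2⟩
      · exact Or.inr ⟨h, h2⟩
    have b2 : cnt H1 ≤ cnt H + cnt (fun u v => (H1 u v ∧ q ^ 2 < τ u) ∨ (H1 u v ∧ q ^ 2 < τ v)) := by
      refine cnt_or fun u v h => ?_
      by_cases h2 : τ u ≤ q ^ 2
      · by_cases h3 : τ v ≤ q ^ 2
        · exact Or.inl ⟨h, h2, h3⟩
        · exact Or.inr (Or.inr ⟨h, not_le.1 h3⟩)
      · exact Or.inr (Or.inl ⟨h, not_le.1 h2⟩)
    have b3 : cnt (fun u v => (H1 u v ∧ q ^ 2 < τ u) ∨ (H1 u v ∧ q ^ 2 < τ v)) ≤ _ :=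
      cnt_or fun u v h => h
    linarith
  · have del : cnt (fun u v => Sat u ∧ Tri G u v) ≤ q ^ 6 := by
      have : cnt (fun u v => Sat u ∧ Tri G u v) ≤ ∑ _u : V, q ^ 2 := by
        refine Finset.sum_le_sum fun u _ => ?_
        by_cases h : Sat u
        · simp only [h, true_and, ← hτ]
          obtain ⟨v, hv⟩ := h
          exact hv.2.1
        · simp only [h, false_and, if_false, Finset.sum_const_zero]; positivity
      refine this.trans (le_of_eq ?_)
      simp [hn]; ring
    have b1 : cnt (fun u v => G.Adj u v ∧ ¬ G'.Adj u v) ≤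
        cnt (fun u v => (Sat u ∧ Tri G u v) ∨ (Sat v ∧ Tri G v u)) := by
      refine cnt_mono fun u v h => ?_
      by_contra hc
      push Not at hc
      exact h.2 ⟨h.1, fun h' => hc.1 h'.1 h'.2, fun h' => hc.2 h'.1 h'.2⟩
    have b2 : cnt (fun u v => (Sat u ∧ Tri G u v) ∨ (Sat v ∧ Tri G v u)) ≤ _ + _ :=
      cnt_or fun u v h => h
    have b3 := cnt_swap (fun u v => Sat u ∧ Tri G u v)
    linarith

end counting

section cases
open Classical

variable {V : Type*} [Fintype V]

theorem wt_ind (R : V → V → Prop) (T : Finset V) :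
    wt R (fun u => if u ∈ T then 0 else 1) = cnt (fun u v => R u v ∧ u ∉ T ∧ v ∉ T) := by
  refine Finset.sum_congr rfl fun u _ => Finset.sum_congr rfl fun v _ => ?_
  by_cases h1 : R u v <;> by_cases h2 : u ∈ T <;> by_cases h3 : v ∈ T <;> simp [h1, h2, h3]

theorem sum_ind (T : Finset V) :
    ∑ u, (if u ∈ T then (0 : ℝ) else 1) = (Fintype.card V : ℝ) - T.card := by
  have : ∀ u, (if u ∈ T then (0 : ℝ) else 1) = 1 - if u ∈ T then (1 : ℝ) else 0 := by
    intro u; split_ifs <;> simp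
  simp [this, Finset.sum_sub_distrib]

theorem restrict_lb (G : SimpleGraph V) (T : Finset V) (M : ℝ)
    (h : ∀ w ∈ T, ((Finset.univ.filter fun x => G.Adj w x).card : ℝ) ≤ M) :
    cnt G.Adj ≤ cnt (fun u v => G.Adj u v ∧ u ∉ T ∧ v ∉ T) + 2 * (T.card * M) := by
  have h1 : cnt (fun u v => u ∈ T ∧ G.Adj u v) ≤ T.card * M := by
    have : cnt (fun u v => u ∈ T ∧ G.Adj u v) ≤ ∑ u, if u ∈ T then M else 0 := by
      refine Finset.sum_le_sum fun u _ => ?_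
      by_cases hu : u ∈ T
      · simpa [hu] using h u hu
      · simp [hu]
    refine this.trans (le_of_eq ?_)
    simp
  have h2 : cnt (fun u v => v ∈ T ∧ G.Adj u v) ≤ T.card * M := by
    refine le_trans ?_ h1
    rw [← cnt_swap]
    exact cnt_mono fun u v h => ⟨h.1, h.2.symm⟩
  have h3 : cnt G.Adj ≤ cnt (fun u v => G.Adj u v ∧ u ∉ T ∧ v ∉ T) +
      cnt (fun u v => (u ∈ T ∧ G.Adj u v) ∨ (v ∈ T ∧ G.Adj u v)) := by
    refine cnt_or fun u v h => ?_
    by_cases a : u ∈ T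
    · exact Or.inr (Or.inl ⟨a, h⟩)
    by_cases b : v ∈ T
    · exact Or.inr (Or.inr ⟨b, h⟩)
    exact Or.inl ⟨h, a, b⟩
  have h4 : cnt (fun u v => (u ∈ T ∧ G.Adj u v) ∨ (v ∈ T ∧ G.Adj u v)) ≤ _ + _ :=
    cnt_or fun u v h => h
  linarith

theorem dense_cover (G : SimpleGraph V) (X Y : Finset V) (x x' : V) (M : ℝ)
    (hX : ∀ a ∈ X, ∀ b ∈ X, ¬ G.Adj a b) (hY : ∀ a ∈ Y, ∀ b ∈ Y, ¬ G.Adj a b)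
    (hxx : G.Adj x x')
    (hmX : ∀ a ∈ X, ((Y.filter fun y => ¬ G.Adj a y).card : ℝ) ≤ M)
    (hmx : ((Y.filter fun y => ¬ G.Adj x y).card : ℝ) ≤ M)
    (hmx' : ((Y.filter fun y => ¬ G.Adj x' y).card : ℝ) ≤ M)
    (hbig : 2 * M + 3 ≤ Y.card) :
    cnt (Blu G) ≤ 2 * (((X ∪ Y)ᶜ.card : ℝ) + 2 + M) * Fintype.card V := by
  let W : Finset V := (X ∪ Y)ᶜ ∪ {x, x'} ∪ Y.filter fun y => ¬ G.Adj x y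
  have hW : (W.card : ℝ) ≤ ((X ∪ Y)ᶜ.card : ℝ) + 2 + M := by
    have h1 : W.card ≤ (X ∪ Y)ᶜ.card + 2 + (Y.filter fun y => ¬ G.Adj x y).card := by
      refine (Finset.card_union_le _ _).trans (Nat.add_le_add_right ?_ _)
      exact (Finset.card_union_le _ _).trans (Nat.add_le_add_left Finset.card_le_two _)
    have h2 : (W.card : ℝ) ≤ ((X ∪ Y)ᶜ.card : ℝ) + 2 + (Y.filter fun y => ¬ G.Adj x y).card := by
      exact_mod_cast h1
    linarith
  have key : ∀ a ∈ X, ∀ b ∈ Y, Blu G a b → a ∈ W ∨ b ∈ W := by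
    intro a ha b hb hab
    by_contra hc
    push Not at hc
    obtain ⟨hc1, hc2⟩ := hc
    simp only [W, Finset.mem_union, Finset.mem_compl, Finset.mem_insert, Finset.mem_singleton,
      Finset.mem_filter, not_or, not_and, not_not] at hc1 hc2
    have hax : a ≠ x := hc1.1.2.1
    have hax' : a ≠ x' := hc1.1.2.2
    have hbx' : b ≠ x' := hc2.1.2.2
    have hxb : G.Adj x b := hc2.2 hb
    have hsub : Y ⊆ (Y.filter fun y => G.Adj a y ∧ G.Adj x' y) ∪
        ((Y.filter fun y => ¬ G.Adj a y) ∪ (Y.filter fun y => ¬ G.Adj x' y)) := by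
      intro y hy
      simp only [Finset.mem_union, Finset.mem_filter, hy, true_and]
      tauto
    have hcard := (Finset.card_le_card hsub).trans ((Finset.card_union_le _ _).trans
      (Nat.add_le_add_left (Finset.card_union_le _ _) _))
    have hcard' : (Y.card : ℝ) ≤ (Y.filter fun y => G.Adj a y ∧ G.Adj x' y).card +
        ((Y.filter fun y => ¬ G.Adj a y).card + (Y.filter fun y => ¬ G.Adj x' y).card) := by
      exact_mod_cast hcard
    have h3 : (3 : ℝ) ≤ (Y.filter fun y => G.Adj a y ∧ G.Adj x' y).card := by
      have := hmX a ha
      linarith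
    obtain ⟨b', hb', n1, n2⟩ := exists_avoid _ (by exact_mod_cast h3) b x
    simp only [Finset.mem_filter] at hb'
    exact hab.symm.2 x x' b' hxb.symm hxx hb'.2.2 hb'.2.1.symm hax.symm hbx'.symm hax'.symm n1
      n2.symm
  have hn : (0 : ℝ) ≤ Fintype.card V := by positivity
  refine (cnt_touch (Blu G) W ?_).trans ?_
  · intro a b hab
    by_cases ha : a ∈ X ∪ Y
    swap
    · left; simp only [W, Finset.mem_union, Finset.mem_compl]; left; left
      simpa using ha
    by_cases hb : b ∈ X ∪ Y
    swap
    · right; simp only [W, Finset.mem_union, Finset.mem_compl]; left; left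
      simpa using hb
    rw [Finset.mem_union] at ha hb
    rcases ha with ha | ha <;> rcases hb with hb | hb
    · exact absurd hab.1 (hX a ha b hb)
    · exact key a ha b hb hab
    · exact (key b hb a ha hab.symm).symm
    · exact absurd hab.1 (hY a ha b hb)
  · exact mul_le_mul_of_nonneg_right (by linarith) hn

theorem miss_bound (G : SimpleGraph V) (X Y : Finset V) (v w : V) (K : ℝ) (hK : 1 ≤ K)
    (hXY : Disjoint X Y)
    (hX : (Fintype.card V : ℝ) / 2 - 4 * K ≤ X.card)
    (hY : (Fintype.card V : ℝ) / 2 - 4 * K ≤ Y.card)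
    (hw : ∀ x ∈ X, G.Adj w x → x = v)
    (hd : (Fintype.card V : ℝ) / 2 - K ≤ (Finset.univ.filter fun x => G.Adj w x).card) :
    ((Y.filter fun y => ¬ G.Adj w y).card : ℝ) ≤ 14 * K := by
  have hsub : (Finset.univ.filter fun x => G.Adj w x) ⊆
      (Y.filter fun y => G.Adj w y) ∪ ((X ∪ Y)ᶜ ∪ {v}) := by
    intro z hz
    simp only [Finset.mem_filter, Finset.mem_univ, true_and] at hz
    simp only [Finset.mem_union, Finset.mem_filter, Finset.mem_compl, Finset.mem_singleton]
    by_cases h1 : z ∈ X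
    · right; right; exact hw z h1 hz
    · tauto
  have h1 := (Finset.card_le_card hsub).trans ((Finset.card_union_le _ _).trans
      (Nat.add_le_add_left (Finset.card_union_le _ _) _))
  rw [Finset.card_singleton] at h1
  have h1' : ((Finset.univ.filter fun x => G.Adj w x).card : ℝ) ≤
    (Y.filter fun y => G.Adj w y).card + ((X ∪ Y)ᶜ.card + 1) := by exact_mod_cast h1
  have h2 : X.card + Y.card + (X ∪ Y)ᶜ.card = Fintype.card V := by
    rw [← Finset.card_union_of_disjoint hXY, Finset.card_add_card_compl]
  have h2' : (X.card : ℝ) + Y.card + (X ∪ Y)ᶜ.card = Fintype.card V := by exact_mod_cast h2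
  have h3 : (Y.filter fun y => G.Adj w y).card + (Y.filter fun y => ¬ G.Adj w y).card = Y.card :=
    Finset.card_filter_add_card_filter_not _
  have h3' : ((Y.filter fun y => G.Adj w y).card : ℝ) + (Y.filter fun y => ¬ G.Adj w y).card
    = Y.card := by exact_mod_cast h3
  linarith

theorem nbr_lb (G : SimpleGraph V) (L : Finset V) (u : V) (K : ℝ)
    (hL : (L.card : ℝ) ≤ 2 * K)
    (hd : (Fintype.card V : ℝ) / 2 - K ≤ (Finset.univ.filter fun x => G.Adj u x).card)
    (hτ : ((Finset.univ.filter fun x => Tri G u x).card : ℝ) ≤ K) :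
    (Fintype.card V : ℝ) / 2 - 4 * K ≤
      (Finset.univ.filter fun x => x ∉ L ∧ G.Adj u x ∧ ¬ Tri G u x).card := by
  have hsub : (Finset.univ.filter fun x => G.Adj u x) ⊆
      (Finset.univ.filter fun x => x ∉ L ∧ G.Adj u x ∧ ¬ Tri G u x) ∪
        (L ∪ (Finset.univ.filter fun x => Tri G u x)) := by
    intro z hz
    simp only [Finset.mem_filter, Finset.mem_univ, true_and, Finset.mem_union] at hz ⊢
    tauto
  have h1 := (Finset.card_le_card hsub).trans ((Finset.card_union_le _ _).trans
      (Nat.add_le_add_left (Finset.card_union_le _ _) _))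
  have h1' : ((Finset.univ.filter fun x => G.Adj u x).card : ℝ) ≤
    (Finset.univ.filter fun x => x ∉ L ∧ G.Adj u x ∧ ¬ Tri G u x).card +
      (L.card + (Finset.univ.filter fun x => Tri G u x).card) := by exact_mod_cast h1
  linarith

theorem case_dense (G : SimpleGraph V) (L : Finset V) (K : ℝ) (hK : 1 ≤ K)
    (hbig : 32 * K + 3 ≤ (Fintype.card V : ℝ) / 2)
    (hL : (L.card : ℝ) ≤ 2 * K)
    (hd : ∀ w, w ∉ L →
      (Fintype.card V : ℝ) / 2 - K ≤ (Finset.univ.filter fun x => G.Adj w x).card)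
    (he : ((Fintype.card V : ℝ) - L.card) ^ 2 / 2 <
      cnt (fun u v => G.Adj u v ∧ u ∉ L ∧ v ∉ L))
    (u v : V) (hu : u ∉ L) (hv : v ∉ L) (huv : Blu G u v) (hnt : ¬ Tri G u v)
    (hτu : ((Finset.univ.filter fun x => Tri G u x).card : ℝ) ≤ K)
    (hτv : ((Finset.univ.filter fun x => Tri G v x).card : ℝ) ≤ K) :
    cnt (Blu G) ≤ 2 * (22 * K + 2) * Fintype.card V := by
  obtain ⟨X, hXd⟩ : ∃ X, X = Finset.univ.filter fun x => x ∉ L ∧ G.Adj u x ∧ ¬ Tri G u x :=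
    ⟨_, rfl⟩
  obtain ⟨Y, hYd⟩ : ∃ Y, Y = Finset.univ.filter fun x => x ∉ L ∧ G.Adj v x ∧ ¬ Tri G v x :=
    ⟨_, rfl⟩
  have mX : ∀ x, x ∈ X ↔ x ∉ L ∧ G.Adj u x ∧ ¬ Tri G u x := by intro x; simp [hXd]
  have mY : ∀ x, x ∈ Y ↔ x ∉ L ∧ G.Adj v x ∧ ¬ Tri G v x := by intro x; simp [hYd]
  have cX := nbr_lb G L u K hL (hd u hu) hτu
  have cY := nbr_lb G L v K hL (hd v hv) hτv
  rw [← hXd] at cX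
  rw [← hYd] at cY
  have hcom : ∀ x, G.Adj u x → G.Adj v x → False := fun x h1 h2 => hnt ⟨huv.1, x, h1, h2⟩
  have hdisj : Disjoint X Y := by
    rw [Finset.disjoint_left]
    intro x h1 h2
    exact hcom x ((mX x).1 h1).2.1 ((mY x).1 h2).2.1
  have iX : ∀ a ∈ X, ∀ b ∈ X, ¬ G.Adj a b := by
    intro a ha b hb h
    exact ((mX a).1 ha).2.2 ⟨((mX a).1 ha).2.1, b, ((mX b).1 hb).2.1, h⟩
  have iY : ∀ a ∈ Y, ∀ b ∈ Y, ¬ G.Adj a b := by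
    intro a ha b hb h
    exact ((mY a).1 ha).2.2 ⟨((mY a).1 ha).2.1, b, ((mY b).1 hb).2.1, h⟩
  have h2 : X.card + Y.card + (X ∪ Y)ᶜ.card = Fintype.card V := by
    rw [← Finset.card_union_of_disjoint hdisj, Finset.card_add_card_compl]
  have h2' : (X.card : ℝ) + Y.card + (X ∪ Y)ᶜ.card = Fintype.card V := by exact_mod_cast h2
  let A : V → Prop := fun w => ∀ x ∈ X, G.Adj w x → x = v
  have hB : ∀ w, ¬ A w → ∀ y ∈ Y, G.Adj w y → y = u := by
    intro w hw y hy hwy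
    simp only [A] at hw
    push Not at hw
    obtain ⟨x, hx, hwx, hxv⟩ := hw
    by_contra hyu
    have hx' := ((mX x).1 hx).2.1
    have hy' := ((mY y).1 hy).2.1
    refine huv.2 x w y hx' hwx.symm hwy hy'.symm hxv ?_ ?_ hyu ?_
    · rintro rfl; exact hcom y hwy hy'
    · rintro rfl; exact hcom x hx' hwx
    · rintro rfl; exact hcom x hx' hy'
  have hn : (0 : ℝ) ≤ Fintype.card V := by positivity
  have hedge : ∃ x x', x ∉ L ∧ x' ∉ L ∧ G.Adj x x' ∧ ¬ (A x ↔ ¬ A x') := by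
    by_contra hc
    push Not at hc
    have := wt_bip G.Adj (fun u => if u ∈ L then 0 else 1)
      (fun u => by split_ifs <;> simp) A (by
        intro x y hx hy hxy
        simp only [ne_eq, ite_eq_left_iff, one_ne_zero, imp_false, not_not] at hx hy
        exact hc x y hx hy hxy)
    rw [wt_ind, sum_ind] at this
    linarith
  obtain ⟨x, x', hx, hx', hxx, hA⟩ := hedge
  have hsplit : (A x ∧ A x') ∨ (¬ A x ∧ ¬ A x') := by tauto
  rcases hsplit with ⟨a1, a2⟩ | ⟨a1, a2⟩
  · have := dense_cover G X Y x x' (14 * K) iX iY hxx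
      (fun a ha => miss_bound G X Y v a K hK hdisj cX cY
        (fun b hb h => absurd h (iX a ha b hb)) (hd a ((mX a).1 ha).1))
      (miss_bound G X Y v x K hK hdisj cX cY a1 (hd x hx))
      (miss_bound G X Y v x' K hK hdisj cX cY a2 (hd x' hx')) (by linarith)
    exact this.trans (mul_le_mul_of_nonneg_right (by linarith) hn)
  · have := dense_cover G Y X x x' (14 * K) iY iX hxx
      (fun a ha => miss_bound G Y X u a K hK hdisj.symm cY cX
        (fun b hb h => absurd h (iY a ha b hb)) (hd a ((mY a).1 ha).1))
      (miss_bound G Y X u x K hK hdisj.symm cY cX (hB x a1) (hd x hx))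
      (miss_bound G Y X u x' K hK hdisj.symm cY cX (hB x' a2) (hd x' hx')) (by linarith)
    rw [Finset.union_comm] at this
    exact this.trans (mul_le_mul_of_nonneg_right (by linarith) hn)

theorem blue_bound (G : SimpleGraph V) (q : ℝ) (hq : 1 ≤ q) (hn : (Fintype.card V : ℝ) = q ^ 4)
    (he : (Fintype.card V : ℝ) ^ 2 / 2 < cnt G.Adj) :
    cnt (Blu G) ≤ (2 - Real.sqrt 2) / 8 * (Fintype.card V : ℝ) ^ 2 + 150 * q ^ 7 := by
  have hq0 : 0 < q := by linarith
  have hs2 : Real.sqrt 2 ≤ 2 := by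
    rw [Real.sqrt_le_left (by norm_num)]; norm_num
  have hc0 : 0 ≤ (2 - Real.sqrt 2) / 8 := by linarith
  have hcn : 0 ≤ (2 - Real.sqrt 2) / 8 * (Fintype.card V : ℝ) ^ 2 := by positivity
  have p67 : q ^ 6 ≤ q ^ 7 := pow_le_pow_right₀ hq (by norm_num)
  have p47 : q ^ 4 ≤ q ^ 7 := pow_le_pow_right₀ hq (by norm_num)
  have p3 : 1 ≤ q ^ 3 := one_le_pow₀ hq
  have p23 : q ^ 2 ≤ q ^ 3 := pow_le_pow_right₀ hq (by norm_num)
  by_cases hsmall : q < 150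
  · have := cnt_le_sq (Blu G)
    rw [hn] at this
    have h8 : (q ^ 4) ^ 2 = q * q ^ 7 := by ring
    have h9 : q * q ^ 7 ≤ 150 * q ^ 7 := mul_le_mul_of_nonneg_right hsmall.le (by positivity)
    linarith
  push Not at hsmall
  obtain ⟨K, hKd⟩ : ∃ K, K = 2 * q ^ 3 := ⟨_, rfl⟩
  have hK1 : 1 ≤ K := by linarith
  obtain ⟨G', H, Hs, hHG, hC, hHB, hblue, hdel⟩ := cleaning G q hq hn
  obtain ⟨L, hLd⟩ : ∃ L : Finset V, L = Finset.univ.filter fun w =>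
    ((Finset.univ.filter fun x => G.Adj w x).card : ℝ) ≤ (Fintype.card V : ℝ) / 2 - K := ⟨_, rfl⟩
  have mL : ∀ w, w ∈ L ↔
    ((Finset.univ.filter fun x => G.Adj w x).card : ℝ) ≤ (Fintype.card V : ℝ) / 2 - K := by
    intro w; simp [hLd]
  have hKn : K * Fintype.card V = 2 * q ^ 7 := by rw [hKd, hn]; ring
  have hKK : K * K = 4 * q ^ 6 := by rw [hKd]; ring
  have hq6 : 0 < q ^ 6 := by positivity
  by_cases hcase : 2 * K ≤ L.card
  · -- many vertices of low degree
    obtain ⟨T, hTL, hTc⟩ := Finset.exists_subset_card_eq (Nat.ceil_le.2 hcase)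
    have ht1 : 2 * K ≤ (T.card : ℝ) := by rw [hTc]; exact Nat.le_ceil _
    have ht2 : (T.card : ℝ) ≤ 2 * K + 1 := by
      rw [hTc]; exact (Nat.ceil_lt_add_one (by linarith)).le
    have hr := restrict_lb G T _ (fun w hw => (mL w).1 (hTL hw))
    have hr2 : cnt (fun u v => G.Adj u v ∧ u ∉ T ∧ v ∉ T) ≤
        cnt (fun u v => G'.Adj u v ∧ u ∉ T ∧ v ∉ T) + 2 * q ^ 6 := by
      have : cnt (fun u v => G.Adj u v ∧ u ∉ T ∧ v ∉ T) ≤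
          cnt (fun u v => G'.Adj u v ∧ u ∉ T ∧ v ∉ T) +
          cnt (fun u v => G.Adj u v ∧ ¬ G'.Adj u v) := by
        refine cnt_or fun u v h => ?_
        by_cases h2 : G'.Adj u v
        · exact Or.inl ⟨h2, h.2⟩
        · exact Or.inr ⟨h.1, h2⟩
      linarith
    have hE : ((Fintype.card V : ℝ) - T.card) ^ 2 / 2 <
        cnt (fun u v => G'.Adj u v ∧ u ∉ T ∧ v ∉ T) := by
      nlinarith
    have hw := weighted_main G' H Hs hHG hC _ (fun u => if u ∈ T then 0 else 1) rfl
      (fun u => by split_ifs <;> simp) (by rw [wt_ind, sum_ind]; exact hE)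
    rw [wt_ind, sum_ind] at hw
    have hsplit : cnt H ≤ cnt (fun u v => H u v ∧ u ∉ T ∧ v ∉ T) +
        cnt (fun u v => u ∈ T ∨ v ∈ T) := by
      refine cnt_or fun u v h => ?_
      tauto
    have htouch := cnt_touch (fun u v : V => u ∈ T ∨ v ∈ T) T (fun u v h => h)
    have hTn : (T.card : ℝ) ≤ Fintype.card V := by exact_mod_cast Finset.card_le_univ T
    have hsq : ((Fintype.card V : ℝ) - T.card) ^ 2 ≤ (Fintype.card V : ℝ) ^ 2 := by
      have h0 : (0 : ℝ) ≤ T.card := by positivity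
      nlinarith
    have hcs := mul_le_mul_of_nonneg_left hsq hc0
    have h5 : 2 * (T.card : ℝ) * Fintype.card V ≤ 2 * (2 * K + 1) * Fintype.card V :=
      mul_le_mul_of_nonneg_right (by linarith) (by positivity)
    have h6 : 2 * (2 * K + 1) * (Fintype.card V : ℝ) = 4 * (K * Fintype.card V) + 2 * q ^ 4 := by
      rw [hn]; ring
    rw [hKn] at h6
    linarith
  · push Not at hcase
    by_cases hHS : ∃ u v, H u v ∧ u ∉ L ∧ v ∉ L
    · obtain ⟨u, v, huv, hu, hv⟩ := hHS
      have hr := restrict_lb G L _ (fun w hw => (mL w).1 hw)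
      have h0 : (0 : ℝ) ≤ L.card := by positivity
      have hE : ((Fintype.card V : ℝ) - L.card) ^ 2 / 2 <
          cnt (fun u v => G.Adj u v ∧ u ∉ L ∧ v ∉ L) := by
        nlinarith
      have hbig : 32 * K + 3 ≤ (Fintype.card V : ℝ) / 2 := by
        rw [hn, hKd]
        have : q ^ 4 = q * q ^ 3 := by ring
        nlinarith
      have hτu := (hHB u v huv).2.2
      have hτv := (hHB v u (Hs _ _ huv)).2.2
      have := case_dense G L K hK1 hbig hcase.le
        (fun w hw => by rw [mL, not_le] at hw; exact hw.le) hE u v hu hv (hHB u v huv).1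
        (hHB u v huv).2.1 (by linarith) (by linarith)
      have h6 : 2 * (22 * K + 2) * (Fintype.card V : ℝ) = 44 * (K * Fintype.card V) + 4 * q ^ 4 := by
        rw [hn]; ring
      rw [hKn] at h6
      linarith
    · push Not at hHS
      have htouch := cnt_touch H L (fun u v h => by
        by_contra hc
        push Not at hc
        exact hc.2 (hHS u v h hc.1))
      have h5 : 2 * (L.card : ℝ) * Fintype.card V ≤ 2 * (2 * K) * Fintype.card V :=
        mul_le_mul_of_nonneg_right (by linarith) (by positivity)
      have h6 : 2 * (2 * K) * (Fintype.card V : ℝ) = 4 * (K * Fintype.card V) := by ring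
      rw [hKn] at h6
      linarith

end cases

section final
open Classical

theorem occurs_of_not_blu {V : Type*} (G : SimpleGraph V) (u v : V) (h : G.Adj u v)
    (hb : ¬ Blu G u v) : occursInC G 5 s(u, v) := by
  have : ∃ x w y, G.Adj u x ∧ G.Adj x w ∧ G.Adj w y ∧ G.Adj y v ∧
    x ≠ v ∧ w ≠ u ∧ w ≠ v ∧ y ≠ u ∧ x ≠ y := by
    by_contra hc
    push Not at hc
    exact hb ⟨h, fun x w y h1 h2 h3 h4 n1 n2 n3 n4 n5 =>
      n5 (hc x w y h1 h2 h3 h4 n1 n2 n3 n4)⟩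
  obtain ⟨x, w, y, h1, h2, h3, h4, n1, n2, n3, n4, n5⟩ := this
  refine ⟨v, Walk.cons h.symm (Walk.cons h1 (Walk.cons h2 (Walk.cons h3 (Walk.cons h4 Walk.nil)))),
    ?_, by simp, by simp⟩
  rw [Walk.cons_isCycle_iff]
  have m1 := h.ne
  have m2 := h1.ne
  have m3 := h2.ne
  have m4 := h3.ne
  have m5 := h4.ne
  constructor
  · simp only [Walk.cons_isPath_iff, Walk.support_cons, Walk.support_nil, List.mem_cons,
      List.not_mem_nil, or_false, not_or, Walk.IsPath.nil, true_and]
    grind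
  · simp only [Walk.edges_cons, Walk.edges_nil, List.mem_cons, List.not_mem_nil, or_false,
      Sym2.eq_iff]
    grind

def BluG {V : Type*} (G : SimpleGraph V) : SimpleGraph V :=
  { Adj := fun u v => Blu G u v
    symm := ⟨fun _ _ h => ⟨h.1.symm, fun x w y h1 h2 h3 h4 n1 n2 n3 n4 n5 =>
      h.2 y w x h4.symm h3.symm h2.symm h1.symm n4 n3 n2 n1 n5.symm⟩⟩
    loopless := ⟨fun _ h => G.irrefl h.1⟩ }

theorem cnt_eq_edges {V : Type*} [Fintype V] (G : SimpleGraph V) :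
    cnt G.Adj = 2 * (G.edgeSet.ncard : ℝ) := by
  have h1 := G.sum_degrees_eq_twice_card_edges
  have h2 : G.edgeSet.ncard = G.edgeFinset.card := by
    rw [← SimpleGraph.coe_edgeFinset, Set.ncard_coe_finset]
  rw [h2]
  have h3 : cnt G.Adj = ((∑ v, G.degree v : ℕ) : ℝ) := by
    push_cast
    refine Finset.sum_congr rfl fun u _ => ?_
    rw [← SimpleGraph.card_neighborFinset_eq_degree, SimpleGraph.neighborFinset_eq_filter]
    simp
  rw [h3, h1]; push_cast; ring

end final

theorem stmt0 :
    ∃ C : ℝ, 0 < C ∧ ∀ n : ℕ, 0 < n → ∀ G : SimpleGraph (Fin n),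
      G.edgeSet.ncard = n ^ 2 / 4 + 1 →
      ((2 + Real.sqrt 2) / 16) * (n : ℝ) ^ 2 - C * (n : ℝ) ^ ((15 : ℝ) / 8)
        ≤ (countEdgesInC G 5 : ℝ) := by
  refine ⟨75, by norm_num, ?_⟩
  intro n hn G hE
  have hn1 : (1 : ℝ) ≤ n := by exact_mod_cast hn
  have hn0 : (0 : ℝ) ≤ n := by linarith
  obtain ⟨q, hqd⟩ : ∃ q : ℝ, q = (n : ℝ) ^ ((1 : ℝ) / 4) := ⟨_, rfl⟩
  have hq1 : 1 ≤ q := by rw [hqd]; exact Real.one_le_rpow hn1 (by norm_num)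
  have hq4 : (n : ℝ) = q ^ 4 := by
    rw [hqd, ← Real.rpow_natCast, ← Real.rpow_mul hn0]; norm_num
  have hq7 : q ^ 7 ≤ (n : ℝ) ^ ((15 : ℝ) / 8) := by
    rw [hqd, ← Real.rpow_natCast, ← Real.rpow_mul hn0]
    exact Real.rpow_le_rpow_of_exponent_le hn1 (by norm_num)
  have hcard : (Fintype.card (Fin n) : ℝ) = n := by simp
  have hG := cnt_eq_edges G
  have hdiv : n ^ 2 < 4 * (n ^ 2 / 4 + 1) := by omega
  rw [← hE] at hdiv
  have hdiv' : (n : ℝ) ^ 2 < 4 * (G.edgeSet.ncard : ℝ) := by exact_mod_cast hdiv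
  have hb := blue_bound G q hq1 (by rw [hcard, hq4]) (by rw [hcard, hG]; linarith)
  rw [hcard] at hb
  have hB : cnt (Blu G) = 2 * ((BluG G).edgeSet.ncard : ℝ) := cnt_eq_edges (BluG G)
  have hsub : G.edgeSet ⊆ {e | e ∈ G.edgeSet ∧ occursInC G 5 e} ∪ (BluG G).edgeSet := by
    intro e he
    induction e using Sym2.ind with
    | _ u v =>
      by_cases h : Blu G u v
      · exact Or.inr h
      · exact Or.inl ⟨he, occurs_of_not_blu G u v he h⟩
  have hle : G.edgeSet.ncard ≤ countEdgesInC G 5 + (BluG G).edgeSet.ncard :=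
    (Set.ncard_le_ncard hsub (Set.toFinite _)).trans (Set.ncard_union_le _ _)
  have hle' : (G.edgeSet.ncard : ℝ) ≤ countEdgesInC G 5 + (BluG G).edgeSet.ncard := by
    exact_mod_cast hle
  linarith
end

section
/- For every integer k ≥ 3 there exists a constant C > 0 such that for every positive integer n, every simple graph G on n vertices with exactly ⌊n²/4⌋ + 1 edges contains at least (2/9)·n² − C·n edges that occur in C_{2k+1}. -/
open SimpleGraph

namespace EFR
open Finset

section lists
variable {V : Type*} {G : SimpleGraph V}

lemma list_walk (z v : V) : ∀ (t : List V) (e : V), (e :: t).Nodup → (e :: t).IsChain G.Adj →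
    [z, v] <:+ (e :: t) → ∃ p : G.Walk e v, p.IsPath ∧ p.length = t.length ∧ s(z, v) ∈ p.edges ∧
      p.support = e :: t := by
  intro t
  induction t with
  | nil =>
    intro e _ _ h
    have := h.length_le
    simp at this
  | cons f t ih =>
    intro e hn hc hs
    rw [List.suffix_cons_iff] at hs
    rw [List.isChain_cons_cons] at hc
    rcases hs with hs | hs
    · simp only [List.cons.injEq] at hs
      obtain ⟨rfl, rfl, rfl⟩ := hs
      refine ⟨Walk.cons hc.1 Walk.nil, ?_, by simp, by simp, by simp⟩
      apply Walk.IsPath.mk'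
      simpa using hn
    · obtain ⟨p, hp, hl, he, hsup⟩ := ih f (List.nodup_cons.1 hn).2 hc.2 hs
      refine ⟨Walk.cons hc.1 p, ?_, by simp [hl], by simp [he], by simp [hsup]⟩
      apply Walk.IsPath.mk'
      simpa [hsup] using hn

/-- No edge of `H` is in a cycle of length `m` of `G`, in terms of lists. -/
def NoCyc (G H : SimpleGraph V) (m : ℕ) : Prop :=
  ∀ (e : V) (t : List V) (z v : V), (e :: t).Nodup → (e :: t).IsChain G.Adj → t.length + 1 = m →
    H.Adj z v → [z, v] <:+ (e :: t) → ¬ G.Adj e v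

lemma occurs_of_list {e : V} {t : List V} {z v : V} {m : ℕ} (hn : (e :: t).Nodup)
    (hc : (e :: t).IsChain G.Adj) (hm : t.length + 1 = m) (h3 : 3 ≤ m)
    (hs : [z, v] <:+ (e :: t)) (ha : G.Adj e v) : occursInC G m s(z, v) := by
  obtain ⟨p, hp, hl, he, hsup⟩ := list_walk z v t e hn hc hs
  refine ⟨v, Walk.cons ha.symm p, ?_, by simp [hl, hm], by simp [he]⟩
  rw [Walk.cons_isCycle_iff]
  refine ⟨hp, ?_⟩
  cases p with
  | nil => exact absurd ha (G.irrefl)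
  | cons h q =>
    rename_i f
    rw [Walk.cons_isPath_iff] at hp
    intro hmem
    rw [Walk.edges_cons, List.mem_cons] at hmem
    rcases hmem with hmem | hmem
    · have : f = v := by
        rcases Sym2.eq_iff.1 hmem with h1 | h1
        · exact absurd h1.1 ha.ne'
        · exact h1.1.symm
      subst this
      have := Walk.length_eq_zero_iff.2 (Walk.isPath_iff_nil.1 hp.1)
      simp [this] at hl
      omega
    · exact hp.2 (Walk.snd_mem_support_of_mem_edges _ hmem)
end lists

section counts
variable {V : Type*} (G : SimpleGraph V)

open Classical in
noncomputable def ad (a b : V) : ℝ := if G.Adj a b then 1 else 0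
noncomputable def dg (a : V) (B : Finset V) : ℝ := ∑ b ∈ B, ad G a b
noncomputable def eb (A B : Finset V) : ℝ := ∑ a ∈ A, dg G a B

variable {G}
lemma ad_nonneg (a b : V) : 0 ≤ ad G a b := by unfold ad; split_ifs <;> norm_num
lemma ad_le_one (a b : V) : ad G a b ≤ 1 := by unfold ad; split_ifs <;> norm_num
lemma ad_comm (a b : V) : ad G a b = ad G b a := by
  unfold ad
  by_cases h : G.Adj a b
  · simp [h, h.symm]
  · have h' : ¬ G.Adj b a := fun hh => h hh.symm
    simp [h, h']
lemma ad_pos {a b : V} (h : 0 < ad G a b) : G.Adj a b := by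
  unfold ad at h; by_contra hh; simp [hh] at h
lemma ad_one {a b : V} (h : G.Adj a b) : ad G a b = 1 := by unfold ad; simp [h]

lemma dg_nonneg (a : V) (B : Finset V) : 0 ≤ dg G a B := sum_nonneg fun _ _ => ad_nonneg _ _
lemma dg_le_card (a : V) (B : Finset V) : dg G a B ≤ #B := by
  unfold dg
  calc _ ≤ ∑ b ∈ B, (1:ℝ) := sum_le_sum fun _ _ => ad_le_one _ _
    _ = _ := by simp
lemma dg_mono (a : V) {B C : Finset V} (h : B ⊆ C) : dg G a B ≤ dg G a C :=
  sum_le_sum_of_subset_of_nonneg h fun _ _ _ => ad_nonneg _ _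
lemma dg_split [DecidableEq V] (a : V) {B C : Finset V} (h : B ⊆ C) :
    dg G a C = dg G a B + dg G a (C \ B) := by
  unfold dg; rw [add_comm, sum_sdiff h]
lemma dg_union [DecidableEq V] (a : V) {B C : Finset V} (h : Disjoint B C) :
    dg G a (B ∪ C) = dg G a B + dg G a C := by
  unfold dg; rw [sum_union h]
lemma dg_le_union [DecidableEq V] (a : V) (B C : Finset V) :
    dg G a (B ∪ C) ≤ dg G a B + dg G a C := by
  have := dg_split (G := G) a (subset_union_left : B ⊆ B ∪ C)
  have h2 : dg G a ((B ∪ C) \ B) ≤ dg G a C := dg_mono a (by intro x; simp; tauto)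
  linarith
lemma dg_filter (a : V) (B : Finset V) [DecidablePred (G.Adj a)] :
    dg G a B = #(B.filter (G.Adj a)) := by
  unfold dg ad; rw [← sum_boole]; exact sum_congr rfl fun b _ => by congr

lemma eb_nonneg (A B : Finset V) : 0 ≤ eb G A B := sum_nonneg fun _ _ => dg_nonneg _ _
lemma eb_comm (A B : Finset V) : eb G A B = eb G B A := by
  unfold eb dg; rw [sum_comm]
  exact sum_congr rfl fun _ _ => sum_congr rfl fun _ _ => ad_comm _ _
lemma eb_split_left [DecidableEq V] {A C : Finset V} (B : Finset V) (h : A ⊆ C) :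
    eb G C B = eb G A B + eb G (C \ A) B := by
  unfold eb; rw [add_comm, sum_sdiff h]
lemma eb_split_right [DecidableEq V] (A : Finset V) {B C : Finset V} (h : B ⊆ C) :
    eb G A C = eb G A B + eb G A (C \ B) := by
  rw [eb_comm A C, eb_split_left A h, eb_comm A, eb_comm A]
/-- total split -/
lemma eb_split [DecidableEq V] {A C : Finset V} (h : A ⊆ C) :
    eb G C C = eb G A A + 2 * eb G A (C \ A) + eb G (C \ A) (C \ A) := by
  rw [eb_split_left C h, eb_split_right A h, eb_split_right (C \ A) h, eb_comm (C \ A) A]; ring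
lemma eb_mono {A A' B B' : Finset V} (h : A ⊆ A') (h' : B ⊆ B') : eb G A B ≤ eb G A' B' := by
  unfold eb
  calc _ ≤ ∑ a ∈ A, dg G a B' := sum_le_sum fun _ _ => dg_mono _ h'
    _ ≤ _ := sum_le_sum_of_subset_of_nonneg h fun _ _ _ => dg_nonneg _ _
lemma eb_le {A B : Finset V} {k : ℝ} (h : ∀ a ∈ A, dg G a B ≤ k) : eb G A B ≤ #A * k := by
  unfold eb
  calc _ ≤ ∑ a ∈ A, k := sum_le_sum h
    _ = _ := by simp
lemma le_eb {A B : Finset V} {k : ℝ} (h : ∀ a ∈ A, k ≤ dg G a B) : #A * k ≤ eb G A B := by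
  unfold eb
  calc _ = ∑ a ∈ A, k := by simp
    _ ≤ _ := sum_le_sum h
lemma eb_le_card (A B : Finset V) : eb G A B ≤ #A * #B := eb_le fun _ _ => dg_le_card _ _
lemma eb_empty_left (B : Finset V) : eb G ∅ B = 0 := by simp [eb]

lemma pick [DecidableEq V] {a : V} {B X : Finset V} (h : (#X : ℝ) < dg G a B) :
    ∃ b ∈ B, G.Adj a b ∧ b ∉ X := by
  classical
  rw [dg_filter] at h
  have : #X < #(B.filter (G.Adj a)) := by exact_mod_cast h
  obtain ⟨b, hb, hx⟩ := exists_mem_notMem_of_card_lt_card this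
  rw [mem_filter] at hb
  exact ⟨b, hb.1, hb.2, hx⟩

/-- nonneighbours restricted to a subset -/
lemma dg_sub_of_missing [DecidableEq V] {a : V} {B C : Finset V} (h : C ⊆ B) :
    (#C : ℝ) - (#B - dg G a B) ≤ dg G a C := by
  have h1 := dg_split (G := G) a h
  have h2 := dg_le_card (G := G) a (B \ C)
  have h3 : (#(B \ C) : ℝ) = #B - #C := by
    rw [card_sdiff_of_subset h, Nat.cast_sub (card_le_card h)]
  linarith

variable (G) in
open Classical in
noncomputable def nb [Fintype V] (v : V) : Finset V := univ.filter (G.Adj v)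
lemma mem_nb [Fintype V] {v w : V} : w ∈ nb G v ↔ G.Adj v w := by simp [nb]
lemma card_nb_inter [Fintype V] [DecidableEq V] (v : V) (B : Finset V) :
    (#(nb G v ∩ B) : ℝ) = dg G v B := by
  classical
  rw [dg_filter]; congr 2; ext x; simp [nb]; tauto
lemma card_nb [Fintype V] (v : V) : (#(nb G v) : ℝ) = dg G v univ := by
  classical
  rw [dg_filter]; congr 2

/-- Markov-type bound -/
lemma markov (A B : Finset V) (k : ℝ) [DecidablePred fun a => k ≤ dg G a B] :
    #(A.filter fun a => k ≤ dg G a B) * k ≤ eb G A B := by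
  refine (le_eb (G := G) (B := B) ?_).trans (eb_mono (filter_subset _ _) Subset.rfl)
  intro a ha; exact (mem_filter.1 ha).2

lemma exists_small {A B : Finset V} {k : ℝ} (hA : A.Nonempty) (h : eb G A B ≤ #A * k) :
    ∃ a ∈ A, dg G a B ≤ k := by
  by_contra hh
  push Not at hh
  have : ∑ a ∈ A, k < ∑ a ∈ A, dg G a B := sum_lt_sum_of_nonempty hA hh
  simp at this
  unfold eb at h
  linarith

lemma greedy [DecidableEq V] (X : Finset V) (D : ℕ) : ∀ (l : ℕ) (S S' : Finset V) (s : V) (l0 : List V),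
    (∀ s ∈ S, (D : ℝ) ≤ dg G s S') → (∀ s ∈ S', (D : ℝ) ≤ dg G s S) → s ∈ S →
    #X + l0.length + l + 2 ≤ D → (s :: l0).Nodup → (s :: l0).IsChain G.Adj →
    ∃ e t, (e :: t).Nodup ∧ (e :: t).IsChain G.Adj ∧ t.length = l + l0.length ∧
      (s :: l0) <:+ (e :: t) ∧ (∀ x ∈ e :: t, x ∈ s :: l0 ∨ (x ∉ X ∧ (x ∈ S ∨ x ∈ S'))) ∧
      (if Even l then e ∈ S else e ∈ S') := by
  intro l
  induction l with
  | zero =>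
    intro S S' s l0 _ _ hs _ hn hc
    exact ⟨s, l0, hn, hc, by simp, List.suffix_rfl, fun x hx => Or.inl hx, by simpa using hs⟩
  | succ l ih =>
    intro S S' s l0 h1 h2 hs hD hn hc
    obtain ⟨b, hb, hab, hbX⟩ := pick (G := G) (a := s) (B := S') (X := X ∪ (s :: l0).toFinset) (by
      refine lt_of_lt_of_le ?_ (h1 s hs)
      have := card_union_le X (s :: l0).toFinset
      have h3 := (s :: l0).toFinset_card_le
      simp only [List.length_cons] at h3
      exact_mod_cast (by omega))
    rw [notMem_union, List.mem_toFinset] at hbX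
    obtain ⟨e, t, q1, q2, q3, q4, q5, q6⟩ := ih S' S b (s :: l0) h2 h1 hb
      (by simp only [List.length_cons]; omega)
      (List.nodup_cons.2 ⟨hbX.2, hn⟩) (List.isChain_cons_cons.2 ⟨hab.symm, hc⟩)
    refine ⟨e, t, q1, q2, by simp only [List.length_cons] at q3; omega,
      (List.suffix_cons _ _).trans q4, ?_, ?_⟩
    · intro x hx
      rcases q5 x hx with h | h
      · rw [List.mem_cons] at h
        rcases h with rfl | h
        · exact Or.inr ⟨hbX.1, Or.inr hb⟩
        · exact Or.inl h
      · exact Or.inr ⟨h.1, h.2.symm⟩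
    · by_cases hl : Even l
      · simp only [hl, if_true] at q6
        have : ¬ Even (l+1) := by simpa [Nat.even_add_one] using hl
        simpa [this] using q6
      · simp only [hl, if_false] at q6
        have : Even (l+1) := by simpa [Nat.even_add_one] using hl
        simpa [this] using q6

/-- dense graphs contain a nonempty subset with large minimum degree -/
lemma core [DecidableEq V] (D : ℝ) : ∀ (m : ℕ) (X : Finset V), #X = m → 2 * D * m < eb G X X →
    ∃ S ⊆ X, S.Nonempty ∧ ∀ s ∈ S, D ≤ dg G s S := by
  intro m
  induction m with
  | zero =>
    intro X hX h
    rw [card_eq_zero] at hX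
    subst hX
    simp [eb] at h
  | succ m ih =>
    intro X hX h
    by_cases hh : ∀ s ∈ X, D ≤ dg G s X
    · exact ⟨X, Subset.rfl, card_pos.1 (by omega), hh⟩
    push Not at hh
    obtain ⟨s, hs, hd⟩ := hh
    have h1 := eb_split (G := G) (singleton_subset_iff.2 hs)
    have h2 : eb G {s} {s} = 0 := by simp [eb, dg, ad]
    have h3 : eb G {s} (X \ {s}) ≤ dg G s X := by
      simp only [eb, sum_singleton]; exact dg_mono s sdiff_subset
    obtain ⟨S, hS, hS2, hS3⟩ := ih (X \ {s}) (by
      rw [card_sdiff_of_subset (singleton_subset_iff.2 hs)]; simp [hX]) (by push_cast at h; linarith)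
    exact ⟨S, hS.trans sdiff_subset, hS2, hS3⟩
end counts
end EFR

namespace EFR
open Finset

lemma markov_missing {V : Type*} {G : SimpleGraph V} (A B : Finset V) (k : ℝ)
    [DecidablePred fun a => dg G a B ≤ #B - k] :
    #(A.filter fun a => dg G a B ≤ #B - k) * k ≤ #A * #B - eb G A B := by
  have h1 : (#A : ℝ) * #B - eb G A B = ∑ a ∈ A, ((#B : ℝ) - dg G a B) := by
    rw [sum_sub_distrib]; simp [eb]
  rw [h1]
  calc _ = ∑ a ∈ A.filter (fun a => dg G a B ≤ #B - k), k := by simp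
    _ ≤ ∑ a ∈ A.filter (fun a => dg G a B ≤ #B - k), ((#B : ℝ) - dg G a B) := by
        apply sum_le_sum
        intro a ha
        have := (mem_filter.1 ha).2
        linarith
    _ ≤ _ := by
        apply sum_le_sum_of_subset_of_nonneg (filter_subset _ _)
        intro a _ _
        have := dg_le_card (G := G) a B
        linarith

lemma near_cycle {V : Type*} [Fintype V] [DecidableEq V] {G H : SimpleGraph V} {k : ℕ} (hk : 3 ≤ k)
    (hcyc : NoCyc G H (2 * k + 1)) {A B A' B' : Finset V} (hd : Disjoint A B)
    (hA' : A' ⊆ A) (hB' : B' ⊆ B) {N : ℝ} (hN : 1000 * (k + 10 : ℝ) ≤ N)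
    (ha : ∀ a ∈ A', #B - N / 100 ≤ dg G a B) (hb : ∀ b ∈ B', #A - N / 100 ≤ dg G b A)
    (hAc : (4 / 10 : ℝ) * N ≤ #A) (hBc : (4 / 10 : ℝ) * N ≤ #B)
    (hAc' : (#A : ℝ) - N / 200 ≤ #A') (hBc' : (#B : ℝ) - N / 200 ≤ #B')
    {x y : V} (hx : x ∈ A) (hy : y ∈ A) (hxy : G.Adj x y) (hxB : N / 36 ≤ dg G x B)
    (hyB : N / 36 ≤ dg G y B) {u v : V} (hu : u ∈ A') (hv : v ∈ B') (hux : u ≠ x) (huy : u ≠ y)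
    (huv : H.Adj u v) (hHG : H ≤ G) : False := by
  have hk' : (3 : ℝ) ≤ k := by exact_mod_cast hk
  obtain ⟨b, hbm, hub, hbv⟩ := pick (G := G) (a := u) (B := nb G x ∩ B) (X := {v}) (by
    have h1 := dg_sub_of_missing (G := G) (a := u) (B := B) (C := nb G x ∩ B) inter_subset_right
    rw [card_nb_inter] at h1
    have h2 := ha u hu
    simp only [card_singleton, Nat.cast_one]
    linarith)
  rw [mem_inter, mem_nb] at hbm
  rw [mem_singleton] at hbv
  obtain ⟨b', hb'm, hyb', hb'X⟩ := pick (G := G) (a := y) (B := B') (X := {b, v}) (by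
    have h1 := dg_sub_of_missing (G := G) (a := y) (B := B) (C := B') hB'
    have h2 : #({b, v} : Finset V) ≤ 2 := card_le_two
    have h3 : (#({b, v} : Finset V) : ℝ) ≤ 2 := by exact_mod_cast h2
    linarith)
  simp only [mem_insert, mem_singleton, not_or] at hb'X
  have hAB : ∀ a ∈ A, ∀ b ∈ B, a ≠ b := fun a ha b hb => by
    rintro rfl; exact disjoint_left.1 hd ha hb
  have huA := hA' hu
  have hvB := hB' hv
  have hb'B := hB' hb'm
  obtain ⟨e, t, q1, q2, q3, q4, q5, q6⟩ := greedy (G := G) ∅ (2 * k + 10) (2 * k - 6) B' A' b'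
    [y, x, b, u, v]
    (by
      intro s hs
      have h1 := dg_sub_of_missing (G := G) (a := s) (B := A) (C := A') hA'
      have h2 := hb s hs
      push_cast
      linarith)
    (by
      intro s hs
      have h1 := dg_sub_of_missing (G := G) (a := s) (B := B) (C := B') hB'
      have h2 := ha s hs
      push_cast
      linarith) hb'm (by simp; omega)
    (by
      have e1 := hAB y hy b hbm.2
      have e2 := hAB y hy v hvB
      have e3 := hAB x hx b hbm.2
      have e4 := hAB x hx v hvB
      have e5 := hAB u huA b hbm.2
      have e6 := hAB u huA v hvB
      have e7 := hAB y hy b' hb'B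
      have e8 := hAB x hx b' hb'B
      have e9 := hAB u huA b' hb'B
      have := hxy.ne
      simp only [List.nodup_cons, List.mem_cons, List.not_mem_nil, not_or]
      grind)
    (by
      simp only [List.isChain_cons_cons, List.isChain_singleton, and_true]
      exact ⟨hyb'.symm, hxy.symm, hbm.1, hub.symm, hHG huv⟩)
  have hev : Even (2 * k - 6) := by
    refine ⟨k - 3, by omega⟩
  simp only [hev, if_true] at q6
  simp only [List.length_cons, List.length_nil] at q3
  obtain ⟨a, ham, hea, haX⟩ := pick (G := G) (a := e) (B := nb G v ∩ A') (X := (e :: t).toFinset) (by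
    have h1 := dg_sub_of_missing (G := G) (a := e) (B := A) (C := nb G v ∩ A')
      (inter_subset_right.trans hA')
    rw [card_nb_inter] at h1
    have h2 := hb e q6
    have h3 := dg_sub_of_missing (G := G) (a := v) (B := A) (C := A') hA'
    have h4 := hb v hv
    have h5 := (e :: t).toFinset_card_le
    have h6 : (#(e :: t).toFinset : ℝ) ≤ 2 * k + 1 := by
      simp only [List.length_cons] at h5
      exact_mod_cast h5.trans (by omega)
    linarith)
  rw [List.mem_toFinset] at haX
  rw [mem_inter, mem_nb] at ham
  refine hcyc a (e :: t) u v (List.nodup_cons.2 ⟨haX, q1⟩)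
    (List.isChain_cons_cons.2 ⟨hea.symm, q2⟩) (by simp only [List.length_cons]; omega) huv ?_ ham.1.symm
  refine List.IsSuffix.trans ?_ (List.suffix_cons _ _)
  refine List.IsSuffix.trans ?_ q4
  exact ⟨[b', y, x, b], rfl⟩

lemma near_core {V : Type*} [Fintype V] [DecidableEq V] {G H : SimpleGraph V} {k : ℕ} (hk : 3 ≤ k)
    (hcyc : NoCyc G H (2 * k + 1)) (hHG : H ≤ G) {A : Finset V} {N : ℝ}
    (hN : 1000 * (k + 10 : ℝ) ≤ N) (hcard : (Fintype.card V : ℝ) = N)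
    (hE : N ^ 2 / 2 < eb G univ univ)
    (hin : eb G A A + eb G (univ \ A) (univ \ A) < N ^ 2 / 10000)
    {x y : V} (hx : x ∈ A) (hy : y ∈ A) (hxy : G.Adj x y) (hxB : N / 36 ≤ dg G x (univ \ A))
    (hyB : N / 36 ≤ dg G y (univ \ A)) : eb H univ univ ≤ N ^ 2 / 18 := by
  classical
  have hk' : (3 : ℝ) ≤ k := by exact_mod_cast hk
  set B := univ \ A with hBdef
  have hd : Disjoint A B := disjoint_sdiff
  have hAB : (#A : ℝ) + #B = N := by
    have h1 : #B + #A = #(univ : Finset V) := card_sdiff_add_card_eq_card (subset_univ A)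
    rw [← hcard, ← card_univ, ← h1]; push_cast; ring
  have hs := eb_split (G := G) (subset_univ A)
  rw [← hBdef] at hs
  have hAB2 := eb_le_card (G := G) A B
  have hN0 : 0 < N := by linarith
  have hprod : (2475 / 10000) * N ^ 2 ≤ (#A : ℝ) * #B := by linarith [sq_nonneg N]
  have hBeq : (#B : ℝ) = N - #A := by linarith
  rw [hBeq] at hprod
  have hA1 : (45 / 100) * N ≤ (#A : ℝ) := by
    by_contra hh; push Not at hh
    have h1 : 0 < (45 / 100 * N - #A) * (55 / 100 * N - #A) := mul_pos (by linarith) (by linarith)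
    linarith
  have hA2 : (#A : ℝ) ≤ (55 / 100) * N := by
    by_contra hh; push Not at hh
    have h1 : 0 < (#A - 45 / 100 * N) * (#A - 55 / 100 * N) := mul_pos (by linarith) (by linarith)
    linarith
  have hquarter : (#A : ℝ) * #B ≤ N ^ 2 / 4 := by
    rw [hBeq]; nlinarith [sq_nonneg ((#A : ℝ) - N / 2)]
  have hA0 := markov_missing (G := G) A B (N / 100)
  have hB0 := markov_missing (G := G) B A (N / 100)
  rw [eb_comm B A] at hB0
  set A0 := A.filter fun a => dg G a B ≤ #B - N / 100
  set B0 := B.filter fun a => dg G a A ≤ #A - N / 100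
  have hA0c : (#A0 : ℝ) ≤ N / 200 := by
    by_contra hh; push Not at hh
    have h1 : N / 200 * (N / 100) < #A0 * (N / 100) :=
      mul_lt_mul_of_pos_right hh (by linarith)
    linarith
  have hB0c : (#B0 : ℝ) ≤ N / 200 := by
    by_contra hh; push Not at hh
    have h1 : N / 200 * (N / 100) < #B0 * (N / 100) :=
      mul_lt_mul_of_pos_right hh (by linarith)
    linarith
  have hA0s : A0 ⊆ A := filter_subset _ _
  have hB0s : B0 ⊆ B := filter_subset _ _
  have hAc' : (#A : ℝ) - N / 200 ≤ #(A \ A0) := by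
    rw [card_sdiff_of_subset hA0s, Nat.cast_sub (card_le_card hA0s)]; linarith
  have hBc' : (#B : ℝ) - N / 200 ≤ #(B \ B0) := by
    rw [card_sdiff_of_subset hB0s, Nat.cast_sub (card_le_card hB0s)]; linarith
  have key : ∀ u ∈ A \ A0, u ≠ x → u ≠ y → ∀ v ∈ B \ B0, ¬ H.Adj u v := by
    intro u hu hux huy v hv huv
    refine near_cycle hk hcyc hd sdiff_subset sdiff_subset hN ?_ ?_ (by linarith) (by linarith)
      hAc' hBc' hx hy hxy hxB hyB hu hv hux huy huv hHG
    · intro a ha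
      rw [mem_sdiff, mem_filter, not_and] at ha
      have := ha.2 ha.1
      linarith
    · intro a ha
      rw [mem_sdiff, mem_filter, not_and] at ha
      have := ha.2 ha.1
      linarith
  have hHmono : ∀ S T : Finset V, eb H S T ≤ eb G S T := by
    intro S T
    unfold eb dg
    refine sum_le_sum fun a _ => sum_le_sum fun b _ => ?_
    unfold ad
    split_ifs with h1 h2
    · exact le_rfl
    · exact absurd (hHG h1) h2
    · norm_num
    · exact le_rfl
  have hHs := eb_split (G := H) (subset_univ A)
  rw [← hBdef] at hHs
  have hl : eb H A B ≤ (N / 200 + 2) * N + N * (N / 200) := by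
    have hsub : A0 ∪ (A ∩ {x, y}) ⊆ A := union_subset hA0s inter_subset_left
    have h1 := eb_split_left (G := H) B hsub
    have h2 := eb_le_card (G := H) (A0 ∪ (A ∩ {x, y})) B
    have h3 : (#(A0 ∪ (A ∩ {x, y})) : ℝ) ≤ N / 200 + 2 := by
      have h4 := card_union_le A0 (A ∩ {x, y})
      have h5 : #(A ∩ {x, y}) ≤ 2 := (card_le_card inter_subset_right).trans card_le_two
      have : (#(A0 ∪ (A ∩ {x, y})) : ℝ) ≤ #A0 + 2 := by exact_mod_cast h4.trans (by omega)
      linarith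
    have h6 := eb_split_right (G := H) (A \ (A0 ∪ (A ∩ {x, y}))) hB0s
    have h7 : eb H (A \ (A0 ∪ (A ∩ {x, y}))) (B \ B0) = 0 := by
      unfold eb dg
      refine sum_eq_zero fun a ha => sum_eq_zero fun b hb => ?_
      simp only [mem_sdiff, mem_union, mem_inter, mem_insert, mem_singleton] at ha
      unfold ad
      rw [if_neg]
      refine key a (mem_sdiff.2 ⟨ha.1, by tauto⟩) (by tauto) (by tauto) b hb
    have h8 := eb_le_card (G := H) (A \ (A0 ∪ (A ∩ {x, y}))) B0
    have h9 : (#(A \ (A0 ∪ (A ∩ {x, y}))) : ℝ) ≤ N := by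
      have : #(A \ (A0 ∪ (A ∩ {x, y}))) ≤ #A := card_le_card sdiff_subset
      have : (#(A \ (A0 ∪ (A ∩ {x, y}))) : ℝ) ≤ #A := by exact_mod_cast this
      linarith
    have h10 : (#B : ℝ) ≤ N := by linarith
    have h11 : (#(A0 ∪ (A ∩ {x, y})) : ℝ) * #B ≤ (N / 200 + 2) * N := by gcongr
    have h12 : (#(A \ (A0 ∪ (A ∩ {x, y}))) : ℝ) * #B0 ≤ N * (N / 200) := by gcongr
    linarith
  have := hHmono A A
  have := hHmono B B
  have : 13000 * N ≤ N * N := mul_le_mul_of_nonneg_right (by linarith) hN0.le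
  linarith

/-- The near bipartite case. -/
lemma near_case {V : Type*} [Fintype V] [DecidableEq V] {G H : SimpleGraph V} {k : ℕ} (hk : 3 ≤ k)
    (hcyc : NoCyc G H (2 * k + 1)) (hHG : H ≤ G) {N : ℝ}
    (hN : 1000 * (k + 10 : ℝ) ≤ N) (hcard : (Fintype.card V : ℝ) = N)
    (hE : N ^ 2 / 2 < eb G univ univ) (hdeg : ∀ v, N / 18 ≤ dg G v univ)
    (hin : ∃ A, eb G A A + eb G (univ \ A) (univ \ A) < N ^ 2 / 10000) :
    eb H univ univ ≤ N ^ 2 / 18 := by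
  classical
  obtain ⟨A1, hA1⟩ := hin
  obtain ⟨A, -, hmin⟩ := exists_min_image (univ : Finset (Finset V))
    (fun A => eb G A A + eb G (univ \ A) (univ \ A)) univ_nonempty
  have hin : eb G A A + eb G (univ \ A) (univ \ A) < N ^ 2 / 10000 :=
    (hmin A1 (mem_univ _)).trans_lt hA1
  -- moving a vertex
  have move : ∀ A : Finset V, (∀ A', eb G A A + eb G (univ \ A) (univ \ A) ≤
      eb G A' A' + eb G (univ \ A') (univ \ A')) → ∀ x ∈ A, N / 36 ≤ dg G x (univ \ A) := by
    intro A hmin x hx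
    have h1 := eb_split (G := G) (singleton_subset_iff.2 hx)
    have h0 : eb G {x} {x} = 0 := by simp [eb, dg, ad]
    have h2 : eb G {x} (A \ {x}) = dg G x A := by
      simp only [eb, sum_singleton]
      rw [dg_split (G := G) x (singleton_subset_iff.2 hx)]
      simp [dg, ad]
    have h3 := hmin (A \ {x})
    have hsub : (univ \ A) ⊆ univ \ (A \ {x}) := sdiff_subset_sdiff Subset.rfl sdiff_subset
    have h4 := eb_split (G := G) hsub
    have h5 : (univ \ (A \ {x})) \ (univ \ A) = {x} := by
      ext z; simp only [mem_sdiff, mem_univ, true_and, mem_singleton]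
      constructor
      · intro h; by_contra hz; exact h.1 ⟨by tauto, hz⟩
      · rintro rfl; simp [hx]
    rw [h5] at h4
    have h6 : eb G (univ \ A) {x} = dg G x (univ \ A) := by
      rw [eb_comm]; simp [eb]
    have h7 := dg_split (G := G) x (subset_univ A)
    have h8 := hdeg x
    linarith
  by_cases hAA : ∃ x ∈ A, ∃ y ∈ A, G.Adj x y
  · obtain ⟨x, hx, y, hy, hxy⟩ := hAA
    have hmv := move A (fun A' => hmin A' (mem_univ _))
    exact near_core hk hcyc hHG hN hcard hE hin hx hy hxy (hmv x hx) (hmv y hy)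
  by_cases hBB : ∃ x ∈ univ \ A, ∃ y ∈ univ \ A, G.Adj x y
  · obtain ⟨x, hx, y, hy, hxy⟩ := hBB
    have hcc : univ \ (univ \ A) = A := by simp
    have hmv := move (univ \ A) (fun A' => by
      rw [hcc, add_comm]; exact hmin A' (mem_univ _))
    exact near_core hk hcyc hHG hN hcard hE (A := univ \ A) (by rw [hcc, add_comm]; exact hin)
      hx hy hxy (hmv x hx) (hmv y hy)
  exfalso
  have z1 : ∀ S : Finset V, (¬ ∃ x ∈ S, ∃ y ∈ S, G.Adj x y) → eb G S S = 0 := by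
    intro S hS
    unfold eb dg
    refine sum_eq_zero fun a ha => sum_eq_zero fun b hb => ?_
    unfold ad
    rw [if_neg]
    intro h; exact hS ⟨a, ha, b, hb, h⟩
  have h1 := eb_split (G := G) (subset_univ A)
  rw [z1 _ hAA, z1 _ hBB] at h1
  have h2 := eb_le_card (G := G) A (univ \ A)
  have hAB : (#A : ℝ) + #(univ \ A) = N := by
    have h1 : #(univ \ A) + #A = #(univ : Finset V) := card_sdiff_add_card_eq_card (subset_univ A)
    rw [← hcard, ← card_univ, ← h1]; push_cast; ring
  nlinarith [sq_nonneg ((#A : ℝ) - #(univ \ A))]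
end EFR

namespace EFR
open Finset
set_option linter.unusedSectionVars false

variable {V : Type*} [Fintype V] [DecidableEq V]

open Classical in
/-- vertices with codegree at least `τ` with `y` -/
noncomputable def XS (G : SimpleGraph V) (τ : ℝ) (y : V) : Finset V :=
  univ.filter fun b => τ ≤ dg G b (nb G y)

lemma mem_XS {G : SimpleGraph V} {τ : ℝ} {y b : V} : b ∈ XS G τ y ↔ τ ≤ dg G b (nb G y) := by
  simp [XS]

lemma card_le_N {N : ℝ} (hcard : (Fintype.card V : ℝ) = N) (A : Finset V) : (#A : ℝ) ≤ N := by
  rw [← hcard]; exact_mod_cast card_le_univ A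

lemma card_compl_N {N : ℝ} (hcard : (Fintype.card V : ℝ) = N) (A : Finset V) :
    (#A : ℝ) + #(univ \ A) = N := by
  have h1 : #(univ \ A) + #A = #(univ : Finset V) := card_sdiff_add_card_eq_card (subset_univ A)
  rw [← hcard, ← card_univ, ← h1]; push_cast; ring

lemma dense_nb {G : SimpleGraph V} {N α β τ : ℝ} (hcard : (Fintype.card V : ℝ) = N) (hτ : 0 ≤ τ)
    {y : V} (h : α ≤ eb G (nb G y) (nb G y)) (hp : β + 2 * (τ * N) ≤ α) :
    β ≤ eb G (XS G τ y) (XS G τ y) := by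
  classical
  set I := nb G y
  have hs : I ∩ XS G τ y ⊆ I := inter_subset_left
  have h1 := eb_split (G := G) hs
  have h2 := eb_split_right (G := G) (I \ (I ∩ XS G τ y)) hs
  have h3 : eb G (I \ (I ∩ XS G τ y)) I ≤ #(I \ (I ∩ XS G τ y)) * τ := by
    refine eb_le fun a ha => ?_
    have : ¬ τ ≤ dg G a I := by
      intro hh
      simp only [mem_sdiff, mem_inter, mem_XS] at ha
      exact ha.2 ⟨ha.1, hh⟩
    linarith
  have h4 : (#(I \ (I ∩ XS G τ y)) : ℝ) * τ ≤ N * τ :=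
    mul_le_mul_of_nonneg_right (card_le_N hcard _) hτ
  rw [eb_comm _ (I ∩ XS G τ y)] at h2
  have h5 := eb_nonneg (G := G) (I \ (I ∩ XS G τ y)) (I \ (I ∩ XS G τ y))
  have h6 : eb G (I ∩ XS G τ y) (I ∩ XS G τ y) ≤ eb G (XS G τ y) (XS G τ y) :=
    eb_mono inter_subset_right inter_subset_right
  linarith

lemma f3_large {G : SimpleGraph V} {N ε0 ε3 : ℝ} (hcard : (Fintype.card V : ℝ) = N) (hN : 0 < N)
    (hE : N ^ 2 / 2 < eb G univ univ) (hε0 : ε0 ≤ 1) (hε3 : 0 ≤ ε3)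
    (hfar : ∀ A, ε0 * N ^ 2 ≤ eb G A A + eb G (univ \ A) (univ \ A)) {F3 : Finset V}
    (hF3 : ∀ y, y ∉ F3 → eb G (nb G y) (nb G y) ≤ ε3 * N ^ 2) :
    (ε0 - 2 * ε3) * N ≤ 4 * #F3 := by
  classical
  set R := univ \ F3 with hR
  have hcc := card_compl_N hcard F3
  rcases R.eq_empty_or_nonempty with hRe | hRe
  · rw [← hR, hRe] at hcc
    simp at hcc
    have : (ε0 - 2 * ε3) * N ≤ 1 * N := mul_le_mul_of_nonneg_right (by linarith) hN.le
    linarith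
  obtain ⟨x, hx, hmax⟩ := exists_max_image R (fun x => dg G x R) hRe
  set B := nb G x ∩ R
  set A := R \ B with hA
  have hBR : B ⊆ R := inter_subset_right
  have hBc : (#B : ℝ) = dg G x R := card_nb_inter x R
  have h1 : eb G A R ≤ #A * #B := eb_le fun a ha => by
    rw [hBc]; exact hmax a (mem_sdiff.1 ha).1
  have h2 := eb_split_right (G := G) A hBR
  rw [← hA] at h2
  have h3 := eb_split (G := G) hBR
  rw [← hA] at h3
  have h4 := eb_split (G := G) (subset_univ F3)
  rw [← hR] at h4
  have h5 := eb_split_right (G := G) F3 (subset_univ F3)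
  have h6 := eb_le_card (G := G) F3 univ
  rw [← hR] at h5
  have hU : (#(univ : Finset V) : ℝ) = N := by rw [card_univ]; exact hcard
  rw [hU] at h6
  have h7 : eb G B B ≤ ε3 * N ^ 2 := by
    refine (eb_mono inter_subset_left inter_subset_left).trans (hF3 x (mem_sdiff.1 hx).2)
  have h8 := hfar B
  have h9 : univ \ B = A ∪ F3 := by
    ext z; simp only [hA, hR, mem_sdiff, mem_univ, true_and, mem_union, B, mem_inter]; tauto
  have hAs : A ⊆ univ \ B := by rw [h9]; exact subset_union_left
  have h10 := eb_split (G := G) hAs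
  have h11 : (univ \ B) \ A ⊆ F3 := by
    rw [h9]; intro z; simp only [mem_sdiff, mem_union]; tauto
  have h12 : eb G A ((univ \ B) \ A) ≤ eb G R F3 := eb_mono sdiff_subset h11
  have h13 : eb G ((univ \ B) \ A) ((univ \ B) \ A) ≤ eb G F3 F3 := eb_mono h11 h11
  rw [eb_comm R F3] at h12
  have h14 : (#A : ℝ) + #B ≤ N := by
    have : (#(R \ B) : ℝ) = #R - #B := by
      rw [card_sdiff_of_subset hBR, Nat.cast_sub (card_le_card hBR)]
    have := card_le_N hcard R
    linarith
  have h15 : 2 * ((#A : ℝ) * #B) ≤ N ^ 2 / 2 := by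
    have : ((#A : ℝ) + #B) ^ 2 ≤ N ^ 2 := pow_le_pow_left₀ (by positivity) h14 2
    linarith [sq_nonneg ((#A : ℝ) - #B)]
  rw [eb_comm A B] at h2
  have h17 := eb_nonneg (G := G) F3 F3
  have h16 : (ε0 - 2 * ε3) * N * N ≤ 4 * #F3 * N := by linarith
  exact le_of_mul_le_mul_right h16 hN

lemma f1_big {G : SimpleGraph V} {N ε0 ε3 ε5 η : ℝ} (hcard : (Fintype.card V : ℝ) = N) (hN : 0 < N)
    (hE : N ^ 2 / 2 < eb G univ univ)
    (hfar : ∀ A, ε0 * N ^ 2 ≤ eb G A A + eb G (univ \ A) (univ \ A))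
    (hη : 0 ≤ η) (hε0 : 0 < ε0) (hε01 : ε0 ≤ 1) (hε3 : ε3 ≤ ε0 ^ 2 / 32) (hp : ε5 + 2 * η ≤ ε3)
    (hε5 : 0 ≤ ε5)
    {z : V} (hz : N / 2 < dg G z univ) :
    ε5 * N ^ 2 ≤ eb G (XS G (η * N) z) (XS G (η * N) z) := by
  classical
  by_cases hI : ε3 * N ^ 2 ≤ eb G (nb G z) (nb G z)
  · refine dense_nb hcard (by positivity) hI ?_
    have := mul_le_mul_of_nonneg_right hp (sq_nonneg N)
    linarith
  push Not at hI
  by_contra hX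
  push Not at hX
  set X := XS G (η * N) z
  set I := nb G z
  set J := univ \ I with hJ
  have hsub : J ∩ X ⊆ J := inter_subset_left
  set S2 := J ∩ X
  set S1 := J \ S2 with hS1
  have hS2 : eb G S2 S2 < ε5 * N ^ 2 := (eb_mono inter_subset_right inter_subset_right).trans_lt hX
  have h1 : eb G S1 I ≤ #S1 * (η * N) := by
    refine eb_le fun a ha => ?_
    simp only [S1, S2, mem_sdiff, mem_inter, not_and, X, mem_XS] at ha
    exact (not_le.1 (ha.2 ha.1)).le
  have h2 := eb_le_card (G := G) S2 I
  have h3 := eb_split_left (G := G) I hsub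
  have h4 := eb_split (G := G) (subset_univ I)
  have h5 := eb_split (G := G) hsub
  have h6 := eb_le_card (G := G) S2 S1
  have h7 := eb_le_card (G := G) S1 S1
  have hc1 := card_compl_N hcard I
  have hc2 : (#S1 : ℝ) = #J - #S2 := by
    rw [card_sdiff_of_subset hsub, Nat.cast_sub (card_le_card hsub)]
  rw [← card_nb] at hz
  rw [← hJ, eb_comm I J] at h4
  rw [← hJ] at hc1
  rw [← hS1] at h3 h5
  have hs1 : (#S1 : ℝ) * (η * N) ≤ N * (η * N) :=
    mul_le_mul_of_nonneg_right (card_le_N hcard _) (by positivity)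
  set i : ℝ := (#I : ℝ)
  set s1 : ℝ := (#S1 : ℝ)
  set s2 : ℝ := (#S2 : ℝ)
  have hi : i = N - s1 - s2 := by linarith
  have hs1' : 0 ≤ s1 := by positivity
  have h8 : 2 * (s2 * i) + 2 * (s2 * s1) + s1 * s1 ≤ N ^ 2 / 2 - s1 ^ 2 := by
    have ha : s2 = N - (i + s1) := by linarith
    have hb : s1 ≤ (i + s1) - N / 2 := by linarith
    have hc : s1 ^ 2 ≤ ((i + s1) - N / 2) ^ 2 := pow_le_pow_left₀ hs1' hb 2
    rw [ha]; linarith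
  have h9 : s1 ^ 2 ≤ (ε0 / 4 * N) ^ 2 := by
    have q1 : (ε3 + 2 * η + ε5) * N ^ 2 ≤ (ε0 ^ 2 / 16) * N ^ 2 :=
      mul_le_mul_of_nonneg_right (by linarith) (sq_nonneg N)
    linarith
  have h10 : s1 ≤ ε0 / 4 * N := le_of_sq_le_sq h9 (by positivity)
  have h11 : s1 * N ≤ ε0 / 4 * N * N := mul_le_mul_of_nonneg_right h10 hN.le
  have h12 := hfar I
  rw [← hJ] at h12
  have h13 : 2 * (s2 * s1) + s1 * s1 ≤ 2 * (s1 * N) := by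
    have : s2 + s1 ≤ N := by linarith [(by positivity : (0:ℝ) ≤ i)]
    have := mul_le_mul_of_nonneg_right this hs1'
    linarith [mul_self_nonneg s1]
  have h14 : ε3 ≤ ε0 / 32 := by
    have : ε0 ^ 2 ≤ ε0 := by rw [sq]; exact mul_le_of_le_one_left hε0.le hε01
    linarith
  have h15 : (ε5 + ε3 + ε0 / 2) * N ^ 2 < ε0 * N ^ 2 :=
    mul_lt_mul_of_pos_right (by linarith) (by positivity)
  linarith

lemma eb_nb (G : SimpleGraph V) (x : V) :
    eb G (nb G x) (nb G x) = ∑ y, ∑ w, ad G x y * (ad G x w * ad G y w) := by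
  classical
  have hs : ∀ f : V → ℝ, ∑ y ∈ nb G x, f y = ∑ y, ad G x y * f y := by
    intro f
    rw [nb, sum_filter]
    refine sum_congr rfl fun y _ => ?_
    unfold ad; split_ifs <;> simp
  unfold eb dg
  rw [hs]
  refine sum_congr rfl fun y _ => ?_
  rw [hs, mul_sum]

lemma f4_dense {G : SimpleGraph V} {N ε3 ε5 η γ3 : ℝ} (hcard : (Fintype.card V : ℝ) = N)
    (hN : 0 < N) (hη : 0 ≤ η) (hε3 : 0 ≤ ε3) (hp : ε5 + η ≤ γ3 * ε3) {F3 : Finset V}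
    (hF3 : ∀ y ∈ F3, ε3 * N ^ 2 ≤ eb G (nb G y) (nb G y)) {u : V} (hu : γ3 * N ≤ dg G u F3) :
    ε5 * N ^ 2 ≤ eb G (XS G (η * N) u) (XS G (η * N) u) := by
  classical
  set X := XS G (η * N) u with hX
  set D := nb G u ∩ F3 with hD
  have hDc : (#D : ℝ) = dg G u F3 := card_nb_inter u F3
  have h1 : (#D : ℝ) * (ε3 * N ^ 2) ≤ ∑ x ∈ D, eb G (nb G x) (nb G x) := by
    calc _ = ∑ x ∈ D, ε3 * N ^ 2 := by simp
      _ ≤ _ := sum_le_sum fun x hx => hF3 x (mem_inter.1 hx).2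
  have h2 : ∑ x ∈ D, eb G (nb G x) (nb G x) =
      ∑ y, ∑ w, ∑ x ∈ D, ad G x y * (ad G x w * ad G y w) := by
    simp_rw [eb_nb]
    rw [sum_comm]
    refine sum_congr rfl fun y _ => ?_
    rw [sum_comm]
  have hnot : ∀ y, y ∉ X → dg G y D ≤ η * N := by
    intro y hy
    have : dg G y D ≤ dg G y (nb G u) := dg_mono _ inter_subset_left
    rw [hX, mem_XS] at hy
    linarith
  have h3 : ∀ y w, ∑ x ∈ D, ad G x y * (ad G x w * ad G y w) ≤
      (if y ∈ X then if w ∈ X then N * ad G y w else 0 else 0) + η * N := by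
    intro y w
    have ha : ∑ x ∈ D, ad G x y * (ad G x w * ad G y w) ≤ N * ad G y w := by
      calc _ ≤ ∑ x ∈ D, ad G y w := by
            refine sum_le_sum fun x _ => ?_
            have h1 := ad_le_one (G := G) x y
            have h2 := ad_le_one (G := G) x w
            have h3 := ad_nonneg (G := G) y w
            have h4 := ad_nonneg (G := G) x w
            calc _ ≤ 1 * (1 * ad G y w) := by gcongr
              _ = _ := by ring
        _ = #D * ad G y w := by simp
        _ ≤ _ := mul_le_mul_of_nonneg_right (card_le_N hcard _) (ad_nonneg _ _)
    have hb : ∑ x ∈ D, ad G x y * (ad G x w * ad G y w) ≤ dg G y D := by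
      refine sum_le_sum fun x _ => ?_
      rw [ad_comm y x]
      have h1 := ad_nonneg (G := G) x y
      have h2 := ad_le_one (G := G) x w
      have h3 := ad_le_one (G := G) y w
      have h4 := ad_nonneg (G := G) y w
      calc _ ≤ ad G x y * (1 * 1) := by gcongr
        _ = _ := by ring
    have hc : ∑ x ∈ D, ad G x y * (ad G x w * ad G y w) ≤ dg G w D := by
      refine sum_le_sum fun x _ => ?_
      rw [ad_comm w x]
      have h1 := ad_le_one (G := G) x y
      have h2 := ad_nonneg (G := G) x w
      have h3 := ad_le_one (G := G) y w
      have h4 := ad_nonneg (G := G) y w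
      calc _ ≤ 1 * (ad G x w * 1) := by gcongr
        _ = _ := by ring
    have hηN : 0 ≤ η * N := by positivity
    by_cases hy : y ∈ X
    · by_cases hw : w ∈ X
      · simp only [hy, hw, if_true]; linarith
      · simp only [hy, hw, if_true, if_false]; linarith [hnot w hw]
    · simp only [hy, if_false]; linarith [hnot y hy]
  have h4 : ∑ y, ∑ w, ∑ x ∈ D, ad G x y * (ad G x w * ad G y w) ≤
      N * eb G X X + η * N * N ^ 2 := by
    calc _ ≤ ∑ y, ∑ w, ((if y ∈ X then if w ∈ X then N * ad G y w else 0 else 0) + η * N) :=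
          sum_le_sum fun y _ => sum_le_sum fun w _ => h3 y w
      _ = _ := by
        simp_rw [sum_add_distrib]
        congr 1
        · unfold eb dg
          rw [mul_sum, ← sum_filter_add_sum_filter_not univ (· ∈ X)]
          have e1 : (univ.filter (· ∈ X)) = X := by ext; simp
          rw [e1, sum_eq_zero (s := univ.filter fun x => x ∉ X), add_zero]
          · refine sum_congr rfl fun y hy => ?_
            simp only [hy, if_true]
            rw [← sum_filter, e1, mul_sum]
          · intro y hy
            simp [(mem_filter.1 hy).2]
        · simp [card_univ, hcard]; ring
  have h5 : γ3 * N * (ε3 * N ^ 2) ≤ #D * (ε3 * N ^ 2) :=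
    mul_le_mul_of_nonneg_right (by rw [hDc]; exact hu) (by positivity)
  have h6 : (ε5 + η) * N ^ 3 ≤ γ3 * ε3 * N ^ 3 := mul_le_mul_of_nonneg_right hp (by positivity)
  have h7 : ε5 * N ^ 2 * N ≤ eb G X X * N := by linarith
  exact le_of_mul_le_mul_right h7 hN
end EFR

namespace EFR
open Finset
set_option linter.unusedSectionVars false

lemma pigeon {Ω ι : Type*} [Fintype Ω] [DecidableEq ι] (Z : Finset ι) (f : ι → Ω → ℝ) {P θ : ℝ}
    (hP : (Fintype.card Ω : ℝ) = P) (hP0 : 0 < P) (hθ : 0 < θ) (h0 : ∀ z ω, 0 ≤ f z ω)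
    (h1 : ∀ z ω, f z ω ≤ 1) (hs : ∀ z ∈ Z, θ * P ≤ ∑ ω, f z ω)
    (hpair : ∀ z ∈ Z, ∀ z' ∈ Z, z ≠ z' → ∑ ω, f z ω * f z' ω ≤ θ ^ 2 / 2 * P) :
    (#Z : ℝ) ≤ 2 / θ ^ 2 := by
  have hcs := sq_sum_le_card_mul_sum_sq (s := (univ : Finset Ω)) (f := fun ω => ∑ z ∈ Z, f z ω)
  rw [card_univ, hP] at hcs
  have e1 : (#Z : ℝ) * (θ * P) ≤ ∑ ω, ∑ z ∈ Z, f z ω := by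
    rw [sum_comm]
    calc _ = ∑ z ∈ Z, θ * P := by simp
      _ ≤ _ := sum_le_sum hs
  have e2 : ∑ ω, (∑ z ∈ Z, f z ω) ^ 2 = ∑ z ∈ Z, ∑ z' ∈ Z, ∑ ω, f z ω * f z' ω := by
    have : ∀ ω, (∑ z ∈ Z, f z ω) ^ 2 = ∑ z ∈ Z, ∑ z' ∈ Z, f z ω * f z' ω := fun ω => by
      rw [sq, sum_mul_sum]
    simp_rw [this]
    rw [sum_comm]
    refine sum_congr rfl fun z _ => ?_
    rw [sum_comm]
  have e3 : ∑ z ∈ Z, ∑ z' ∈ Z, ∑ ω, f z ω * f z' ω ≤ #Z * P + #Z * (#Z * (θ ^ 2 / 2 * P)) := by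
    calc _ ≤ ∑ z ∈ Z, ∑ z' ∈ Z, ((if z = z' then P else 0) + θ ^ 2 / 2 * P) := by
          refine sum_le_sum fun z hz => sum_le_sum fun z' hz' => ?_
          by_cases h : z = z'
          · simp only [h, if_true]
            have : ∑ ω, f z' ω * f z' ω ≤ ∑ ω : Ω, (1 : ℝ) :=
              sum_le_sum fun ω _ => mul_le_one₀ (h1 _ _) (h0 _ _) (h1 _ _)
            simp [hP] at this
            have : 0 ≤ θ ^ 2 / 2 * P := by positivity
            linarith
          · simp only [h, if_false, zero_add]
            exact hpair z hz z' hz' h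
      _ = _ := by
        simp_rw [sum_add_distrib]
        simp
  have e4 : ((#Z : ℝ) * (θ * P)) ^ 2 ≤ P * (#Z * P + #Z * (#Z * (θ ^ 2 / 2 * P))) := by
    refine (pow_le_pow_left₀ (by positivity) e1 2).trans (hcs.trans ?_)
    rw [e2]
    exact mul_le_mul_of_nonneg_left e3 hP0.le
  rcases eq_or_lt_of_le (Nat.cast_nonneg (α := ℝ) (#Z)) with h | h
  · rw [← h]; positivity
  · rw [le_div_iff₀ (by positivity)]
    have e5 : (#Z : ℝ) * θ ^ 2 * (#Z * P ^ 2) ≤ 2 * (#Z * P ^ 2) := by linarith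
    exact le_of_mul_le_mul_right e5 (by positivity)

variable {V : Type*} [Fintype V] [DecidableEq V]

/-- indicator of tuples (b,c,a,d) with b~c, a ∈ Y ∩ N(b), d ∈ Y ∩ N(c) -/
noncomputable def tup (G : SimpleGraph V) (Y : Finset V) (w : V × V × V × V) : ℝ :=
  ad G w.1 w.2.1 * ((if w.2.2.1 ∈ Y then ad G w.1 w.2.2.1 else 0) *
    (if w.2.2.2 ∈ Y then ad G w.2.1 w.2.2.2 else 0))

lemma ite_ad_nonneg {G : SimpleGraph V} {Y : Finset V} (a b : V) :
    0 ≤ (if a ∈ Y then ad G b a else 0) := by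
  split_ifs
  · exact ad_nonneg _ _
  · exact le_rfl
lemma ite_ad_le_one {G : SimpleGraph V} {Y : Finset V} (a b : V) :
    (if a ∈ Y then ad G b a else 0) ≤ 1 := by
  split_ifs
  · exact ad_le_one _ _
  · norm_num
lemma tup_nonneg {G : SimpleGraph V} {Y : Finset V} (w : V × V × V × V) : 0 ≤ tup G Y w :=
  mul_nonneg (ad_nonneg _ _) (mul_nonneg (ite_ad_nonneg _ _) (ite_ad_nonneg _ _))
lemma tup_le_one {G : SimpleGraph V} {Y : Finset V} (w : V × V × V × V) : tup G Y w ≤ 1 :=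
  mul_le_one₀ (ad_le_one _ _) (mul_nonneg (ite_ad_nonneg _ _) (ite_ad_nonneg _ _))
    (mul_le_one₀ (ite_ad_le_one _ _) (ite_ad_nonneg _ _) (ite_ad_le_one _ _))
lemma tup_mul {G : SimpleGraph V} {Y Y' : Finset V} (w : V × V × V × V) :
    tup G Y w * tup G Y' w ≤ tup G (Y ∩ Y') w := by
  by_cases h : w.2.2.1 ∈ Y ∩ Y' ∧ w.2.2.2 ∈ Y ∩ Y'
  · have h1 := mem_inter.1 h.1
    have h2 := mem_inter.1 h.2
    have e1 : tup G (Y ∩ Y') w = tup G Y w := by simp [tup, h1, h2]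
    rw [e1]
    exact mul_le_of_le_one_right (tup_nonneg _) (tup_le_one _)
  · have : tup G Y w * tup G Y' w = 0 := by
      simp only [mem_inter] at h
      simp only [tup]
      by_cases a1 : w.2.2.1 ∈ Y <;> by_cases a2 : w.2.2.1 ∈ Y' <;> by_cases a3 : w.2.2.2 ∈ Y <;>
        by_cases a4 : w.2.2.2 ∈ Y' <;> simp_all
    rw [this]; exact tup_nonneg _
lemma tup_sum (G : SimpleGraph V) (Y : Finset V) :
    ∑ w, tup G Y w = ∑ b, ∑ c, ad G b c * (dg G b Y * dg G c Y) := by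
  have hd : ∀ b, dg G b Y = ∑ a, if a ∈ Y then ad G b a else 0 := by
    intro b; unfold dg; rw [← sum_filter]; congr 1; ext; simp
  simp_rw [Fintype.sum_prod_type, tup, hd]
  refine sum_congr rfl fun b _ => sum_congr rfl fun c _ => ?_
  rw [sum_mul_sum, mul_sum]
  refine sum_congr rfl fun a _ => ?_
  rw [mul_sum]

lemma tup_lower {G : SimpleGraph V} {τ : ℝ} (hτ : 0 ≤ τ) (z : V) :
    eb G (XS G τ z) (XS G τ z) * (τ * τ) ≤ ∑ w, tup G (nb G z) w := by
  classical
  rw [tup_sum, eb, sum_mul]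
  calc _ ≤ ∑ b ∈ XS G τ z, ∑ c ∈ XS G τ z, ad G b c * (dg G b (nb G z) * dg G c (nb G z)) := by
        refine sum_le_sum fun b hb => ?_
        rw [dg, sum_mul]
        refine sum_le_sum fun c hc => ?_
        rw [mem_XS] at hb hc
        refine mul_le_mul_of_nonneg_left ?_ (ad_nonneg _ _)
        exact mul_le_mul hb hc hτ (dg_nonneg _ _)
    _ ≤ ∑ b ∈ XS G τ z, ∑ c, ad G b c * (dg G b (nb G z) * dg G c (nb G z)) := by
        refine sum_le_sum fun b hb => sum_le_sum_of_subset_of_nonneg (subset_univ _) ?_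
        intro c _ _
        exact mul_nonneg (ad_nonneg _ _) (mul_nonneg (dg_nonneg _ _) (dg_nonneg _ _))
    _ ≤ _ := by
        refine sum_le_sum_of_subset_of_nonneg (subset_univ _) ?_
        intro b _ _
        exact sum_nonneg fun c _ =>
          mul_nonneg (ad_nonneg _ _) (mul_nonneg (dg_nonneg _ _) (dg_nonneg _ _))

lemma tup_upper {G : SimpleGraph V} {N D : ℝ} (hcard : (Fintype.card V : ℝ) = N) (hD : 0 ≤ D)
    (Y X : Finset V) (hX : ∀ b, b ∉ X → dg G b Y ≤ D) :
    ∑ w, tup G Y w ≤ N ^ 2 * eb G X X + D * N * N ^ 2 := by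
  classical
  have hN : 0 ≤ N := by rw [← hcard]; positivity
  rw [tup_sum]
  have h3 : ∀ y w, ad G y w * (dg G y Y * dg G w Y) ≤
      (if y ∈ X then if w ∈ X then N ^ 2 * ad G y w else 0 else 0) + D * N := by
    intro y w
    have hy := dg_nonneg (G := G) y Y
    have hw := dg_nonneg (G := G) w Y
    have hy' := (dg_le_card (G := G) y Y).trans (card_le_N hcard Y)
    have hw' := (dg_le_card (G := G) w Y).trans (card_le_N hcard Y)
    have ha := ad_nonneg (G := G) y w
    have ha' := ad_le_one (G := G) y w
    have hDN : 0 ≤ D * N := by positivity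
    by_cases hyX : y ∈ X
    · by_cases hwX : w ∈ X
      · simp only [hyX, hwX, if_true]
        have : ad G y w * (dg G y Y * dg G w Y) ≤ ad G y w * (N * N) := by gcongr
        linarith
      · simp only [hyX, hwX, if_true, if_false]
        have h1 := hX w hwX
        calc _ ≤ 1 * (N * D) := by gcongr
          _ = _ := by ring
    · simp only [hyX, if_false]
      have h1 := hX y hyX
      calc _ ≤ 1 * (D * N) := by gcongr
        _ = _ := by ring
  calc _ ≤ ∑ y, ∑ w, ((if y ∈ X then if w ∈ X then N ^ 2 * ad G y w else 0 else 0) + D * N) :=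
        sum_le_sum fun y _ => sum_le_sum fun w _ => h3 y w
    _ = _ := by
      simp_rw [sum_add_distrib]
      congr 1
      · unfold eb dg
        rw [mul_sum, ← sum_filter_add_sum_filter_not univ (· ∈ X)]
        have e1 : (univ.filter (· ∈ X)) = X := by ext; simp
        rw [e1, sum_eq_zero (s := univ.filter fun x => x ∉ X), add_zero]
        · refine sum_congr rfl fun y hy => ?_
          simp only [hy, if_true]
          rw [← sum_filter, e1, mul_sum]
        · intro y hy
          simp [(mem_filter.1 hy).2]
      · simp [card_univ, hcard]; ring

lemma f2_cycle {G H : SimpleGraph V} {k : ℕ} (hk : 3 ≤ k)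
    (hcyc : NoCyc G H (2 * k + 1)) (hHG : H ≤ G) {v z z' : V} (hz : H.Adj z v) (hz' : H.Adj z' v)
    (hne : z ≠ z') {S : Finset V} (hS : S.Nonempty)
    (hSd : ∀ s ∈ S, ((2 * k + 10 : ℕ) : ℝ) ≤ dg G s S)
    (hSY : ∀ s ∈ S, ((2 * k + 10 : ℕ) : ℝ) ≤ dg G s (nb G z ∩ nb G z')) : False := by
  have hk' : (3 : ℝ) ≤ k := by exact_mod_cast hk
  obtain ⟨s0, hs0⟩ := hS
  obtain ⟨s, hs, -, hsX⟩ := pick (G := G) (a := s0) (B := S) (X := {v, z, z'}) (by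
    refine lt_of_lt_of_le ?_ (hSd s0 hs0)
    have : #({v, z, z'} : Finset V) ≤ 3 := card_le_three
    exact_mod_cast (by omega))
  simp only [mem_insert, mem_singleton, not_or] at hsX
  obtain ⟨a, ha, hsa, haX⟩ := pick (G := G) (a := s) (B := nb G z ∩ nb G z') (X := {v}) (by
    refine lt_of_lt_of_le ?_ (hSY s hs)
    rw [card_singleton]
    exact_mod_cast (by omega))
  rw [mem_inter, mem_nb, mem_nb] at ha
  rw [mem_singleton] at haX
  have n1 := (hHG hz).ne
  have n2 := (hHG hz').ne
  have n3 := ha.1.ne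
  have n4 := ha.2.ne
  have n5 := hsa.ne
  obtain ⟨e, t, q1, q2, q3, q4, q5, q6⟩ := greedy (G := G) {z'} (2 * k + 10) (2 * k - 5) S S s
    [a, z, v] hSd hSd hs (by simp; omega)
    (by
      simp only [List.nodup_cons, List.mem_cons, List.not_mem_nil, not_or]
      grind)
    (by
      simp only [List.isChain_cons_cons, List.isChain_singleton, and_true]
      exact ⟨hsa, ha.1.symm, hHG hz⟩)
  have he : e ∈ S := by
    split_ifs at q6 <;> exact q6
  simp only [List.length_cons, List.length_nil] at q3
  have hz't : z' ∉ e :: t := by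
    intro hh
    rcases q5 z' hh with h | h
    · simp only [List.mem_cons, List.not_mem_nil, or_false] at h
      grind
    · simp at h
  obtain ⟨d, hd, hed, hdX⟩ := pick (G := G) (a := e) (B := nb G z ∩ nb G z')
    (X := (e :: t).toFinset) (by
      refine lt_of_lt_of_le ?_ (hSY e he)
      have h5 := (e :: t).toFinset_card_le
      simp only [List.length_cons] at h5
      exact_mod_cast (by omega))
  rw [List.mem_toFinset] at hdX
  rw [mem_inter, mem_nb, mem_nb] at hd
  refine hcyc z' (d :: e :: t) z v ?_ ?_ (by simp only [List.length_cons]; omega) hz ?_ (hHG hz')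
  · refine List.nodup_cons.2 ⟨?_, List.nodup_cons.2 ⟨hdX, q1⟩⟩
    rw [List.mem_cons, not_or]
    exact ⟨hd.2.ne, hz't⟩
  · exact List.isChain_cons_cons.2 ⟨hd.2, List.isChain_cons_cons.2 ⟨hed.symm, q2⟩⟩
  · refine List.IsSuffix.trans ?_ (List.suffix_cons _ _)
    refine List.IsSuffix.trans ?_ (List.suffix_cons _ _)
    refine List.IsSuffix.trans ?_ q4
    exact ⟨[s, a], rfl⟩

lemma f2_few {G H : SimpleGraph V} {k : ℕ} (hk : 3 ≤ k)
    (hcyc : NoCyc G H (2 * k + 1)) (hHG : H ≤ G) {N ε5 η : ℝ}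
    (hcard : (Fintype.card V : ℝ) = N) (hN : 0 < N) (hη : 0 < η) (hε5 : 0 < ε5)
    (hbig : 6 * (2 * k + 10 : ℝ) < (ε5 * η ^ 2) ^ 2 * N) {F : Finset V}
    (hF : ∀ z ∈ F, ε5 * N ^ 2 ≤ eb G (XS G (η * N) z) (XS G (η * N) z)) (v : V) :
    dg H v F ≤ 2 / (ε5 * η ^ 2) ^ 2 := by
  classical
  rw [← card_nb_inter]
  have hΩ : (Fintype.card (V × V × V × V) : ℝ) = N ^ 4 := by
    simp [hcard]; ring
  refine pigeon (P := N ^ 4) _ (fun z => tup G (nb G z)) hΩ (by positivity) (by positivity)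
    (fun _ _ => tup_nonneg _) (fun _ _ => tup_le_one _) ?_ ?_
  · intro z hz
    have h1 := hF z (mem_inter.1 hz).2
    have h2 := tup_lower (G := G) (τ := η * N) (by positivity) z
    have h3 := mul_le_mul_of_nonneg_right h1 (show 0 ≤ (η * N) * (η * N) by positivity)
    linarith
  · intro z hz z' hz' hne
    rw [mem_inter, mem_nb] at hz hz'
    by_contra hh
    push Not at hh
    set Y := nb G z ∩ nb G z' with hY
    set X := univ.filter fun b => ((2 * k + 10 : ℕ) : ℝ) ≤ dg G b Y with hX
    have h1 : ∑ w, tup G (nb G z) w * tup G (nb G z') w ≤ ∑ w, tup G Y w :=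
      sum_le_sum fun w _ => tup_mul w
    have h2 := tup_upper (G := G) (D := ((2 * k + 10 : ℕ) : ℝ)) hcard (by positivity) Y X (by
      intro b hb
      simp only [hX, mem_filter, mem_univ, true_and, not_le] at hb
      exact hb.le)
    have h3 : 2 * ((2 * k + 10 : ℕ) : ℝ) * N < eb G X X := by
      have e1 : ((ε5 * η ^ 2) ^ 2 / 2 * N ^ 2) * N ^ 2 <
        (eb G X X + ((2 * k + 10 : ℕ) : ℝ) * N) * N ^ 2 := by linarith
      have e2 := lt_of_mul_lt_mul_right e1 (by positivity)
      have e3 := mul_lt_mul_of_pos_right hbig hN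
      push_cast at e2 ⊢
      linarith
    obtain ⟨S, hS1, hS2, hS3⟩ := core (G := G) ((2 * k + 10 : ℕ) : ℝ) _ X rfl (by
      refine lt_of_le_of_lt ?_ h3
      exact mul_le_mul_of_nonneg_left (card_le_N hcard _) (by positivity))
    refine f2_cycle hk hcyc hHG hz.1.symm hz'.1.symm hne hS2 hS3 ?_
    intro s hs
    exact (mem_filter.1 (hS1 hs)).2
end EFR

namespace EFR
open Finset
set_option linter.unusedSectionVars false
variable {V : Type*} [Fintype V] [DecidableEq V]

lemma card_sdiff_real {A B : Finset V} : (#A : ℝ) - #B ≤ #(A \ B) := by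
  have := le_card_sdiff B A
  have : #A ≤ #(A \ B) + #B := by omega
  have : (#A : ℝ) ≤ #(A \ B) + #B := by exact_mod_cast this
  linarith

lemma coarse {G : SimpleGraph V} {N η ε5 : ℝ} (hcard : (Fintype.card V : ℝ) = N) (hN : 0 < N)
    (hη : η ≤ 1 / 1000) (hε5 : ε5 ≤ 1 / 100000)
    (hfar : ∀ A, 1 / 10000 * N ^ 2 ≤ eb G A A + eb G (univ \ A) (univ \ A))
    {F F3 Ex : Finset V} (hF3F : F3 ⊆ F)
    (hF3n : ∀ y, y ∉ F3 → eb G (nb G y) (nb G y) ≤ 1 / 8000000000000 * N ^ 2)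
    (hFn : ∀ v, v ∉ F → eb G (XS G (η * N) v) (XS G (η * N) v) < ε5 * N ^ 2)
    (hf3 : 1 / 80000 * N ≤ #F3)
    (hf4 : ∀ u, u ∉ F → dg G u F3 ≤ 1 / 3200000000 * N)
    (hW : ∀ u, u ∉ F → N / 19 ≤ dg G u (univ \ F))
    (hEx : ∀ z ∈ F, z ∉ Ex → N / 2 < dg G z univ)
    (hExc : (#Ex : ℝ) ≤ 1 / 3200000000 * N) {z : V} (hzF : z ∈ F) (hzF3 : z ∉ F3) (hzE : z ∉ Ex) :
    dg G z (univ \ F) ≤ 1 / 800000000 * N := by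
  classical
  by_contra hcon
  push Not at hcon
  set W := univ \ F with hWd
  set I := nb G z with hI
  set J := univ \ I with hJ
  have hII := hF3n z hzF3
  rw [← hI] at hII
  have hIW : (#(I ∩ W) : ℝ) = dg G z W := card_nb_inter z W
  have hN2 : 0 < N ^ 2 := by positivity
  obtain ⟨u, hu, hud⟩ := exists_small (G := G) (A := I ∩ W) (B := I) (k := N / 10000)
    (by
      rw [← card_pos]
      have : (0 : ℝ) < #(I ∩ W) := by rw [hIW]; exact lt_trans (by positivity) hcon
      exact_mod_cast this)
    (by
      have h1 : eb G (I ∩ W) I ≤ eb G I I := eb_mono inter_subset_left Subset.rfl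
      rw [hIW]
      have h2 := mul_lt_mul_of_pos_right hcon (show 0 < N / 10000 by positivity)
      linarith)
  rw [mem_inter] at hu
  have huF : u ∉ F := (mem_sdiff.1 hu.2).2
  have hsplit : W ⊆ (W ∩ J) ∪ I := by
    intro x hx
    by_cases h : x ∈ I
    · exact mem_union_right _ h
    · exact mem_union_left _ (mem_inter.2 ⟨hx, mem_sdiff.2 ⟨mem_univ _, h⟩⟩)
  have hQ : N / 20 ≤ #(W ∩ J) := by
    have h1 := hW u huF
    have h2 := dg_mono (G := G) u hsplit
    have h3 := dg_le_union (G := G) u (W ∩ J) I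
    have h4 := dg_le_card (G := G) u (W ∩ J)
    linarith
  -- a vertex of F3 with few neighbours in W
  have hF3E : 1 / 160000 * N ≤ #(F3 \ Ex) := by
    have := card_sdiff_real (A := F3) (B := Ex)
    linarith
  obtain ⟨x, hx, hxd⟩ := exists_small (G := G) (A := F3 \ Ex) (B := W) (k := N / 20000)
    (by
      rw [← card_pos]
      have : (0 : ℝ) < #(F3 \ Ex) := by linarith
      exact_mod_cast this)
    (by
      have h1 : eb G (F3 \ Ex) W ≤ eb G W F3 := by
        rw [eb_comm]; exact eb_mono Subset.rfl sdiff_subset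
      have h2 : eb G W F3 ≤ #W * (1 / 3200000000 * N) :=
        eb_le fun a ha => hf4 a (mem_sdiff.1 ha).2
      have h3 : (#W : ℝ) * (1 / 3200000000 * N) ≤ N * (1 / 3200000000 * N) :=
        mul_le_mul_of_nonneg_right (card_le_N hcard _) (by positivity)
      have h4 := mul_le_mul_of_nonneg_right hF3E (show 0 ≤ N / 20000 by positivity)
      linarith)
  rw [mem_sdiff] at hx
  have hxu := hEx x (hF3F hx.1) hx.2
  have hFc : 4999 / 10000 * N ≤ #F := by
    have h1 := dg_split (G := G) x (subset_univ F)
    rw [← hWd] at h1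
    have h2 := dg_le_card (G := G) x F
    linarith
  have hIc : N / 2 < #I := by rw [hI, card_nb]; exact hEx z hzF hzE
  have hIJ := card_compl_N hcard I
  rw [← hJ] at hIJ
  have hIF : 48 / 1000 * N ≤ #((I ∩ F) \ Ex) := by
    have h1 : #F ≤ #(I ∩ F) + #(J ∩ F) := by
      rw [← card_union_of_disjoint]
      · apply card_le_card
        intro y hy
        by_cases h : y ∈ I
        · exact mem_union_left _ (mem_inter.2 ⟨h, hy⟩)
        · exact mem_union_right _ (mem_inter.2 ⟨mem_sdiff.2 ⟨mem_univ _, h⟩, hy⟩)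
      · exact disjoint_sdiff.mono inter_subset_left inter_subset_left
    have h2 : #(W ∩ J) + #(J ∩ F) ≤ #J := by
      rw [← card_union_of_disjoint]
      · exact card_le_card (union_subset inter_subset_right inter_subset_left)
      · exact (disjoint_sdiff (s := F)).symm.mono inter_subset_left inter_subset_right
    have h3 : (#F : ℝ) ≤ #(I ∩ F) + #(J ∩ F) := by exact_mod_cast h1
    have h4 : (#(W ∩ J) : ℝ) + #(J ∩ F) ≤ #J := by exact_mod_cast h2
    have h5 := card_sdiff_real (A := I ∩ F) (B := Ex)
    linarith
  set I1 := (I ∩ F) \ Ex with hI1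
  have hI1I : I1 ⊆ I := sdiff_subset.trans inter_subset_left
  have hmiss : (#J : ℝ) * #I1 - eb G J I1 ≤ 1 / 8000000000000 * N ^ 2 := by
    have h1 : eb G I1 I ≤ eb G I I := eb_mono hI1I Subset.rfl
    have h2 : (#I1 : ℝ) * #J ≤ eb G I1 univ := le_eb fun a ha => by
      have ha' := mem_sdiff.1 ha
      have := hEx a (mem_inter.1 ha'.1).2 ha'.2
      linarith
    have h3 := eb_split_right (G := G) I1 (subset_univ I)
    rw [← hJ] at h3
    rw [eb_comm J I1]
    linarith
  have hbad := markov_missing (G := G) J I1 (N / 100)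
  set Jb := J.filter fun j => dg G j I1 ≤ #I1 - N / 100 with hJb
  have hJbc : (#Jb : ℝ) ≤ 1 / 80000000000 * N := by
    have h1 : (#Jb : ℝ) * (N / 100) ≤ (1 / 80000000000 * N) * (N / 100) := by linarith
    exact le_of_mul_le_mul_right h1 (by positivity)
  obtain ⟨v, hv, hvb⟩ := exists_mem_notMem_of_card_lt_card (s := Jb) (t := W ∩ J) (by
    have : (#Jb : ℝ) < #(W ∩ J) := by linarith
    exact_mod_cast this)
  rw [mem_inter] at hv
  have hgood : ∀ j ∈ J, j ∉ Jb → #I1 - N / 100 < dg G j I1 := by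
    intro j hj hjb
    rw [hJb, mem_filter, not_and] at hjb
    exact not_le.1 (hjb hj)
  have hvd := hgood v hv.2 hvb
  have hsubX : J \ Jb ⊆ XS G (η * N) v := by
    intro j hj
    rw [mem_sdiff] at hj
    rw [mem_XS]
    have h1 := hgood j hj.1 hj.2
    have h2 := dg_sub_of_missing (G := G) (a := j) (B := I1) (C := nb G v ∩ I1) inter_subset_right
    rw [card_nb_inter] at h2
    have h3 : dg G j (nb G v ∩ I1) ≤ dg G j (nb G v) := dg_mono _ inter_subset_left
    have h4 := mul_le_mul_of_nonneg_right hη hN.le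
    linarith
  have hX := hFn v (mem_sdiff.1 hv.1).2
  have h1 : eb G (J \ Jb) (J \ Jb) ≤ eb G (XS G (η * N) v) (XS G (η * N) v) := eb_mono hsubX hsubX
  have hJbJ : Jb ⊆ J := filter_subset _ _
  have h2 := eb_split (G := G) hJbJ
  have h3 := eb_split_right (G := G) Jb hJbJ
  have h4 := eb_le_card (G := G) Jb J
  have h5 : (#Jb : ℝ) * #J ≤ (1 / 80000000000 * N) * N := by
    have := card_le_N hcard J
    gcongr
  have h6 := hfar I
  rw [← hJ] at h6
  have h7 := eb_nonneg (G := G) Jb Jb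
  have h8 := mul_le_mul_of_nonneg_right hε5 hN2.le
  linarith

lemma fine_cycle {G H : SimpleGraph V} {k : ℕ} (hk : 3 ≤ k)
    (hcyc : NoCyc G H (2 * k + 1)) (hHG : H ≤ G) {F F0 : Finset V} (hF0 : F0 ⊆ F) {N : ℝ}
    (hN : 1000 * (k + 10 : ℝ) ≤ N) (hF0c : N / 2 ≤ #F0)
    (hF0d : ∀ s ∈ F0, #F0 - N / 100 ≤ dg G s F0)
    {u u' r z z' : V} (hu : u ∉ F) (hu' : u' ∉ F) (hz : z ∈ F) (hz' : z' ∈ F)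
    (huu : u ≠ u') (hzz : z ≠ z') (hzr : z ≠ r) (hzr' : z' ≠ r) (hur : H.Adj u r)
    (hur' : H.Adj u' r) (huz : G.Adj u z) (huz' : G.Adj u' z')
    (hzd : N / 10 ≤ dg G z F0) (hzd' : N / 10 ≤ dg G z' F0) : False := by
  have hk' : (3 : ℝ) ≤ k := by exact_mod_cast hk
  have hFn : ∀ x ∈ F0, ∀ y, y ∉ F → x ≠ y := fun x hx y hy h => hy (h ▸ hF0 hx)
  have hFn' : ∀ x ∈ F, ∀ y, y ∉ F → x ≠ y := fun x hx y hy h => hy (h ▸ hx)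
  obtain ⟨a, ha, hza, haX⟩ := pick (G := G) (a := z) (B := F0) (X := {r, z'}) (by
    have h2 : #({r, z'} : Finset V) ≤ 2 := card_le_two
    have h3 : (#({r, z'} : Finset V) : ℝ) ≤ 2 := by exact_mod_cast h2
    linarith)
  simp only [mem_insert, mem_singleton, not_or] at haX
  have hSd : ∀ s ∈ F0, ((2 * k + 10 : ℕ) : ℝ) ≤ dg G s F0 := by
    intro s hs
    have := hF0d s hs
    push_cast
    linarith
  have m1 := hFn a ha u hu
  have m2 := hFn' z hz u hu
  have m3 := hFn' z' hz' u hu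
  have m4 := hFn a ha u' hu'
  have m5 := hFn' z hz u' hu'
  have m6 := hFn' z' hz' u' hu'
  have m7 := (hHG hur).ne
  have m8 := (hHG hur').ne
  have m9 := hza.ne
  obtain ⟨e, t, q1, q2, q3, q4, q5, q6⟩ := greedy (G := G) {z'} (2 * k + 10) (2 * k - 6) F0 F0 a
    [z, u, r] hSd hSd ha (by simp; omega)
    (by
      simp only [List.nodup_cons, List.mem_cons, List.not_mem_nil, not_or]
      grind)
    (by
      simp only [List.isChain_cons_cons, List.isChain_singleton, and_true]
      exact ⟨hza.symm, huz.symm, hHG hur⟩)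
  have he : e ∈ F0 := by
    split_ifs at q6 <;> exact q6
  simp only [List.length_cons, List.length_nil] at q3
  have hz't : z' ∉ e :: t := by
    intro hh
    rcases q5 z' hh with h | h
    · simp only [List.mem_cons, List.not_mem_nil, or_false] at h
      grind
    · simp at h
  have hu't : u' ∉ e :: t := by
    intro hh
    rcases q5 u' hh with h | h
    · simp only [List.mem_cons, List.not_mem_nil, or_false] at h
      grind
    · have := h.2
      rw [or_self] at this
      exact hu' (hF0 this)
  obtain ⟨b, hb, heb, hbX⟩ := pick (G := G) (a := e) (B := nb G z' ∩ F0)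
    (X := (e :: t).toFinset) (by
      have h1 := dg_sub_of_missing (G := G) (a := e) (B := F0) (C := nb G z' ∩ F0) inter_subset_right
      rw [card_nb_inter] at h1
      have h2 := hF0d e he
      have h5 := (e :: t).toFinset_card_le
      have h6 : (#(e :: t).toFinset : ℝ) ≤ 2 * k + 1 := by
        simp only [List.length_cons] at h5
        exact_mod_cast h5.trans (by omega)
      linarith)
  rw [List.mem_toFinset] at hbX
  rw [mem_inter, mem_nb] at hb
  have m10 := hb.1.ne
  have m11 := hFn b hb.2 u' hu'
  refine hcyc u' (z' :: b :: e :: t) u r ?_ ?_ (by simp only [List.length_cons]; omega) hur ?_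
    (hHG hur')
  · refine List.nodup_cons.2 ⟨?_, List.nodup_cons.2 ⟨?_, List.nodup_cons.2 ⟨hbX, q1⟩⟩⟩
    · rw [List.mem_cons, List.mem_cons, not_or, not_or]
      exact ⟨m6.symm, m11.symm, hu't⟩
    · rw [List.mem_cons, not_or]
      exact ⟨m10, hz't⟩
  · exact List.isChain_cons_cons.2 ⟨huz', List.isChain_cons_cons.2 ⟨hb.1,
      List.isChain_cons_cons.2 ⟨heb.symm, q2⟩⟩⟩
  · refine List.IsSuffix.trans ?_ (List.suffix_cons _ _)
    refine List.IsSuffix.trans ?_ (List.suffix_cons _ _)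
    refine List.IsSuffix.trans ?_ (List.suffix_cons _ _)
    refine List.IsSuffix.trans ?_ q4
    exact ⟨[a, z], rfl⟩
end EFR

namespace EFR
open Finset
set_option linter.unusedSectionVars false
variable {V : Type*} [Fintype V] [DecidableEq V]

lemma eb_mono_graph {G H : SimpleGraph V} (hHG : H ≤ G) (S T : Finset V) : eb H S T ≤ eb G S T := by
  unfold eb dg
  refine sum_le_sum fun a _ => sum_le_sum fun b _ => ?_
  unfold ad
  split_ifs with h1 h2
  · exact le_rfl
  · exact absurd (hHG h1) h2
  · norm_num
  · exact le_rfl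

lemma few_of_codeg {H : SimpleGraph V} {N M : ℝ} (hcard : (Fintype.card V : ℝ) = N) (hN : 0 < N)
    {S : Finset V} (h1 : ∀ s ∈ S, N / 18 ≤ dg H s univ) (h2 : ∀ v, dg H v S ≤ M) :
    (#S : ℝ) ≤ 18 * M := by
  have h3 := le_eb (G := H) h1
  have h4 := eb_le (G := H) (A := univ) (B := S) fun a _ => h2 a
  rw [eb_comm, card_univ, hcard] at h4
  have h5 : (#S : ℝ) * N ≤ 18 * M * N := by linarith
  exact le_of_mul_le_mul_right h5 hN

lemma finish {G H : SimpleGraph V} {k : ℕ} (hk : 3 ≤ k)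
    (hcyc : NoCyc G H (2 * k + 1)) (hHG : H ≤ G) {N M : ℝ}
    (hN : 1000 * (k + 10 : ℝ) ≤ N) (hcard : (Fintype.card V : ℝ) = N)
    (hE : N ^ 2 / 2 < eb G univ univ) {F F3 Ex : Finset V} (hF3F : F3 ⊆ F) (hExF : Ex ⊆ F)
    (hExM : (#Ex : ℝ) ≤ 18 * M) (hExc : (#Ex : ℝ) ≤ 1 / 3200000000 * N)
    (hf3 : 1 / 80000 * N ≤ #F3)
    (hf4 : ∀ u, u ∉ F → dg G u F3 ≤ 1 / 3200000000 * N)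
    (hco : ∀ z ∈ F, z ∉ F3 → z ∉ Ex → dg G z (univ \ F) ≤ 1 / 800000000 * N)
    (hEx : ∀ z ∈ F, z ∉ Ex → N / 2 < dg G z univ)
    (hWW : eb G (univ \ F) (univ \ F) ≤ (#(univ \ F) : ℝ) ^ 2 / 2) (hw : N / 3 < #(univ \ F))
    (hWH : ∀ u, u ∉ F → N / 18 ≤ dg H u univ) :
    3 * (#(univ \ F) : ℝ) ≤ N + 8 * (22 + 18 * M) := by
  classical
  have hk' : (3 : ℝ) ≤ k := by exact_mod_cast hk
  have hN0 : 0 < N := by linarith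
  set W := univ \ F with hWd
  have hFW := card_compl_N hcard F
  rw [← hWd] at hFW
  have hsp := eb_split (G := G) (subset_univ F)
  rw [← hWd] at hsp
  have hFF := eb_le_card (G := G) F F
  have hF3c : (#F3 : ℝ) ≤ #F := by exact_mod_cast card_le_card hF3F
  have hWN := card_le_N hcard W
  -- the coarse bound on e(F,W)
  have hc1 : eb G F W ≤ 1 / 400000000 * N ^ 2 := by
    have h1 := eb_split_left (G := G) W hF3F
    have h2 := eb_split_left (G := G) W (inter_subset_left : (F \ F3) ∩ Ex ⊆ F \ F3)
    have h3 : eb G F3 W ≤ #W * (1 / 3200000000 * N) := by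
      rw [eb_comm]; exact eb_le fun a ha => hf4 a (mem_sdiff.1 ha).2
    have h4 : eb G ((F \ F3) ∩ Ex) W ≤ eb G Ex W := eb_mono inter_subset_right Subset.rfl
    have h5 := eb_le_card (G := G) Ex W
    have h6 : eb G ((F \ F3) \ ((F \ F3) ∩ Ex)) W ≤
        #((F \ F3) \ ((F \ F3) ∩ Ex)) * (1 / 800000000 * N) := by
      refine eb_le fun a ha => ?_
      simp only [mem_sdiff, mem_inter, not_and] at ha
      exact hco a ha.1.1 ha.1.2 (ha.2 ha.1)
    have h7 := card_le_N hcard ((F \ F3) \ ((F \ F3) ∩ Ex))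
    have h8 : (#W : ℝ) * (1 / 3200000000 * N) ≤ N * (1 / 3200000000 * N) := by gcongr
    have h9 : (#Ex : ℝ) * #W ≤ (1 / 3200000000 * N) * N := by gcongr
    have h10 : (#((F \ F3) \ ((F \ F3) ∩ Ex)) : ℝ) * (1 / 800000000 * N) ≤
      N * (1 / 800000000 * N) := by gcongr
    have := sq_nonneg N
    linarith
  have hFeq : (#F : ℝ) = N - #W := by linarith
  have hw3 : (N - #W) * (3 * #W - N) ≤ 1 / 50000000 * N ^ 2 := by
    rw [hFeq] at hFF
    linarith [sq_nonneg N]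
  have hw4 : 3 * (#W : ℝ) - N ≤ 16 / 10000 * N := by
    have h1 : (1 / 80000 * N) * (3 * #W - N) ≤ (N - #W) * (3 * #W - N) :=
      mul_le_mul_of_nonneg_right (by linarith) (by linarith)
    have h2 : (3 * (#W : ℝ) - N) * (1 / 80000 * N) ≤ (16 / 10000 * N) * (1 / 80000 * N) := by
      linarith
    exact le_of_mul_le_mul_right h2 (by positivity)
  have hmiss : (#F : ℝ) * #F - eb G F F ≤ 1 / 100000000 * N ^ 2 := by
    have h1 : 0 ≤ (N - #W) * (3 * #W - N) := mul_nonneg (by linarith) (by linarith)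
    rw [hFeq]
    linarith
  have hbad := markov_missing (G := G) F F (N / 1000)
  set Fb := F.filter fun f => dg G f F ≤ #F - N / 1000 with hFb
  have hFbc : (#Fb : ℝ) ≤ 1 / 100000 * N := by
    have h1 : (#Fb : ℝ) * (N / 1000) ≤ (1 / 100000 * N) * (N / 1000) := by linarith
    exact le_of_mul_le_mul_right h1 (by positivity)
  have hFbF : Fb ⊆ F := filter_subset _ _
  set F0 := F \ Fb with hF0
  have hF0c : (#F0 : ℝ) = #F - #Fb := by
    rw [card_sdiff_of_subset hFbF, Nat.cast_sub (card_le_card hFbF)]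
  have hF0F : F0 ⊆ F := sdiff_subset
  have hF0d : ∀ s ∈ F0, #F0 - N / 100 ≤ dg G s F0 := by
    intro s hs
    have h1 := dg_sub_of_missing (G := G) (a := s) (B := F) (C := F0) hF0F
    rw [hF0, mem_sdiff, hFb, mem_filter, not_and] at hs
    have := not_le.1 (hs.2 hs.1)
    linarith
  have hzd : ∀ z ∈ F, z ∉ Ex → N / 10 ≤ dg G z F0 := by
    intro z hz hzE
    have h1 := hEx z hz hzE
    have h2 := dg_split (G := G) z (subset_univ F)
    rw [← hWd] at h2
    have h3 := dg_le_card (G := G) z W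
    have h4 := dg_split (G := G) z hFbF
    have h5 := dg_le_card (G := G) z Fb
    linarith
  set U1 := W.filter fun u => (4 : ℝ) ≤ dg G u (F \ Ex) with hU1
  have hU1c : (#U1 : ℝ) ≤ 18 * 1 := by
    refine few_of_codeg (H := H) hcard hN0 ?_ ?_
    · intro s hs
      exact hWH s (mem_sdiff.1 (mem_filter.1 hs).1).2
    · intro r
      rw [← card_nb_inter]
      have : #(nb H r ∩ U1) ≤ 1 := by
        rw [card_le_one]
        intro u hu u' hu'
        by_contra hne
        rw [mem_inter, mem_nb, hU1, mem_filter] at hu hu'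
        obtain ⟨z, hz, huz, hzX⟩ := pick (G := G) (a := u) (B := F \ Ex) (X := {r}) (by
          rw [card_singleton]; push_cast; linarith [hu.2.2])
        obtain ⟨z', hz', huz', hzX'⟩ := pick (G := G) (a := u') (B := F \ Ex) (X := {r, z}) (by
          have h2 : #({r, z} : Finset V) ≤ 2 := card_le_two
          have h3 : (#({r, z} : Finset V) : ℝ) ≤ 2 := by exact_mod_cast h2
          linarith [hu'.2.2])
        rw [mem_singleton] at hzX
        simp only [mem_insert, mem_singleton, not_or] at hzX'
        rw [mem_sdiff] at hz hz'
        exact fine_cycle hk hcyc hHG hF0F hN (by linarith) hF0d (mem_sdiff.1 hu.2.1).2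
          (mem_sdiff.1 hu'.2.1).2 hz.1 hz'.1 hne (Ne.symm hzX'.2) hzX hzX'.1 hu.1.symm hu'.1.symm
          huz huz' (hzd z hz.1 hz.2) (hzd z' hz'.1 hz'.2)
      exact_mod_cast this
  -- the fine bound on e(F,W)
  have hfine : eb G F W ≤ (22 + 18 * M) * N := by
    have h1 := eb_split_left (G := G) W hExF
    have h2 := eb_le_card (G := G) Ex W
    have h3 : (#Ex : ℝ) * #W ≤ 18 * M * N := by
      have : 0 ≤ 18 * M := le_trans (by positivity) hExM
      gcongr
    have h4 := eb_split_left (G := G) (F \ Ex) (filter_subset _ _ : U1 ⊆ W)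
    have h5 := eb_le_card (G := G) U1 (F \ Ex)
    have h6 := card_le_N hcard (F \ Ex)
    have h7 : (#U1 : ℝ) * #(F \ Ex) ≤ 18 * 1 * N := by gcongr
    have h8 : eb G (W \ U1) (F \ Ex) ≤ #(W \ U1) * 4 := by
      refine eb_le fun a ha => ?_
      rw [mem_sdiff, hU1, mem_filter, not_and] at ha
      exact (not_le.1 (ha.2 ha.1)).le
    have h9 := card_le_N hcard (W \ U1)
    rw [eb_comm (F \ Ex) W] at h1
    linarith
  have h1 : (N - #W) * (3 * #W - N) ≤ 4 * (22 + 18 * M) * N := by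
    rw [hFeq] at hFF
    linarith
  have h2 : (N / 2) * (3 * #W - N) ≤ (N - #W) * (3 * #W - N) :=
    mul_le_mul_of_nonneg_right (by linarith) (by linarith)
  have h3 : (3 * (#W : ℝ) - N) * (N / 2) ≤ (8 * (22 + 18 * M)) * (N / 2) := by linarith
  have h4 := le_of_mul_le_mul_right h3 (by positivity)
  linarith

theorem one_step {k : ℕ} (hk : 3 ≤ k) : ∃ C1 M N0 : ℝ, 0 < C1 ∧ 0 < M ∧ 1 ≤ N0 ∧
    ∀ (V : Type) [Fintype V] [DecidableEq V] (G H : SimpleGraph V) (N : ℝ),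
    H ≤ G → NoCyc G H (2 * k + 1) → (Fintype.card V : ℝ) = N → N0 ≤ N →
    N ^ 2 / 2 < eb G univ univ → (∀ v, dg G v univ ≤ N / 2 → N / 18 ≤ dg H v univ) →
    eb H univ univ ≤ N ^ 2 / 18 + C1 * N ∨
    ∃ W : Finset V, (#W : ℝ) ≤ (1 - 1 / 80000) * N ∧ (#W : ℝ) ^ 2 / 2 < eb G W W ∧
      eb H univ univ ≤ eb H W W + 2 * M * N := by
  obtain ⟨η, hηd⟩ : ∃ η : ℝ, η = 1 / 51200000000000000000000 := ⟨_, rfl⟩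
  have hη : 0 < η := by rw [hηd]; norm_num
  set θ := η * η ^ 2 with hθ
  have hθ0 : 0 < θ := by positivity
  set M := 2 / θ ^ 2 with hM
  have hM0 : 0 < M := by positivity
  set K := 22 + 18 * M with hK
  have hK0 : 0 < K := by positivity
  refine ⟨K + 4 * K ^ 2 + 2 * M, M, 1000 * (k + 10) + 6 * (2 * k + 10) / θ ^ 2 + 1 +
    18 * M * 3200000000, by positivity, hM0, ?_, ?_⟩
  · have : (0 : ℝ) ≤ 6 * (2 * k + 10) / θ ^ 2 := by positivity
    have : (0 : ℝ) ≤ 1000 * (k + 10) := by positivity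
    linarith
  intro V _ _ G H N hHG hcyc hcard hN hE hH2
  classical
  have p1 : (0 : ℝ) ≤ 6 * (2 * k + 10) / θ ^ 2 := by positivity
  have p2 : (0 : ℝ) ≤ 1000 * (k + 10) := by positivity
  have hN1 : 1000 * (k + 10 : ℝ) ≤ N := by linarith
  have hN0 : 1 ≤ N := by linarith
  have hNpos : 0 < N := by linarith
  have hN3 : 18 * M ≤ 1 / 3200000000 * N := by linarith
  have hN4 : 6 * (2 * k + 10 : ℝ) < θ ^ 2 * N := by
    have h1 : 6 * (2 * k + 10 : ℝ) / θ ^ 2 < N := by linarith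
    rw [div_lt_iff₀ (by positivity)] at h1
    linarith
  by_cases hfar : ∃ A, eb G A A + eb G (univ \ A) (univ \ A) < N ^ 2 / 10000
  · left
    have := near_case hk hcyc hHG hN1 hcard hE (by
      intro v
      by_cases h : dg G v univ ≤ N / 2
      · have h1 := hH2 v h
        have h2 := eb_mono_graph hHG {v} univ
        simp only [eb, sum_singleton] at h2
        linarith
      · linarith) hfar
    have : 0 ≤ (K + 4 * K ^ 2 + 2 * M) * N := by positivity
    linarith
  push Not at hfar
  have hfar' : ∀ A, 1 / 10000 * N ^ 2 ≤ eb G A A + eb G (univ \ A) (univ \ A) := fun A => by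
    linarith [hfar A]
  set F3 := univ.filter fun y => 1 / 8000000000000 * N ^ 2 ≤ eb G (nb G y) (nb G y) with hF3
  set F := univ.filter fun y => η * N ^ 2 ≤ eb G (XS G (η * N) y) (XS G (η * N) y) with hF
  have hF3n : ∀ y, y ∉ F3 → eb G (nb G y) (nb G y) ≤ 1 / 8000000000000 * N ^ 2 := by
    intro y hy
    simp only [hF3, mem_filter, mem_univ, true_and, not_le] at hy
    exact hy.le
  have hF3y : ∀ y ∈ F3, 1 / 8000000000000 * N ^ 2 ≤ eb G (nb G y) (nb G y) := by
    intro y hy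
    exact (mem_filter.1 hy).2
  have hFn : ∀ v, v ∉ F → eb G (XS G (η * N) v) (XS G (η * N) v) < η * N ^ 2 := by
    intro y hy
    simpa only [hF, mem_filter, mem_univ, true_and, not_le] using hy
  have hFy : ∀ v ∈ F, η * N ^ 2 ≤ eb G (XS G (η * N) v) (XS G (η * N) v) := by
    intro y hy
    exact (mem_filter.1 hy).2
  have hFm : ∀ v, η * N ^ 2 ≤ eb G (XS G (η * N) v) (XS G (η * N) v) → v ∈ F := by
    intro v hv; exact mem_filter.2 ⟨mem_univ _, hv⟩
  have hF3F : F3 ⊆ F := by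
    intro y hy
    refine hFm y (dense_nb hcard (by positivity) (hF3y y hy) ?_)
    have : (η + 2 * η) * N ^ 2 ≤ 1 / 8000000000000 * N ^ 2 :=
      mul_le_mul_of_nonneg_right (by rw [hηd]; norm_num) (sq_nonneg N)
    linarith
  have hf3 : 1 / 80000 * N ≤ #F3 := by
    have h := f3_large (ε0 := 1 / 10000) (ε3 := 1 / 8000000000000) hcard hNpos hE (by norm_num)
      (by norm_num) hfar' hF3n
    linarith
  have hf1 : ∀ z, z ∉ F → dg G z univ ≤ N / 2 := by
    intro z hz
    by_contra hh
    push Not at hh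
    refine hz (hFm z (f1_big (ε0 := 1 / 10000) (ε3 := 1 / 8000000000000) hcard hNpos hE hfar' hη.le
      (by norm_num) (by norm_num) (by norm_num) (by rw [hηd]; norm_num) hη.le hh))
  have hf4 : ∀ u, u ∉ F → dg G u F3 ≤ 1 / 3200000000 * N := by
    intro u hu
    by_contra hh
    push Not at hh
    exact hu (hFm u (f4_dense hcard hNpos hη.le (by norm_num) (by rw [hηd]; norm_num) hF3y hh.le))
  have hf2 : ∀ v, dg H v F ≤ M := fun v => f2_few hk hcyc hHG hcard hNpos hη hη hN4 hFy v
  set W := univ \ F with hW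
  have hFWc := card_compl_N hcard F
  rw [← hW] at hFWc
  have hF3c : (#F3 : ℝ) ≤ #F := by exact_mod_cast card_le_card hF3F
  have hHW : eb H univ univ ≤ eb H W W + 2 * M * N := by
    have h1 := eb_split (G := H) (subset_univ F)
    rw [← hW] at h1
    have h2 := eb_le (G := H) (A := univ) (B := F) fun a _ => hf2 a
    rw [card_univ, hcard] at h2
    have h3 := eb_split_left (G := H) F (subset_univ F)
    rw [← hW, eb_comm W F] at h3
    have := eb_nonneg (G := H) F F
    linarith
  by_cases hWW : (#W : ℝ) ^ 2 / 2 < eb G W W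
  · right
    exact ⟨W, by linarith, hWW, hHW⟩
  left
  push Not at hWW
  have hHWW := eb_mono_graph hHG W W
  by_cases hw : (#W : ℝ) ≤ N / 3
  · have h1 : (#W : ℝ) ^ 2 ≤ (N / 3) ^ 2 := pow_le_pow_left₀ (by positivity) hw 2
    have h2 : 0 ≤ (K + 4 * K ^ 2) * N := by positivity
    linarith
  push Not at hw
  set Ex := F.filter fun z => dg G z univ ≤ N / 2 with hEx
  have hExF : Ex ⊆ F := filter_subset _ _
  have hExM : (#Ex : ℝ) ≤ 18 * M := by
    refine few_of_codeg (H := H) hcard hNpos (fun s hs => hH2 s (mem_filter.1 hs).2) ?_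
    intro v
    exact (dg_mono v hExF).trans (hf2 v)
  have hExc : (#Ex : ℝ) ≤ 1 / 3200000000 * N := hExM.trans hN3
  have hExd : ∀ z ∈ F, z ∉ Ex → N / 2 < dg G z univ := by
    intro z hz hzE
    rw [hEx, mem_filter, not_and] at hzE
    exact not_le.1 (hzE hz)
  have hWH : ∀ u, u ∉ F → N / 18 ≤ dg H u univ := fun u hu => hH2 u (hf1 u hu)
  have hWd : ∀ u, u ∉ F → N / 19 ≤ dg G u (univ \ F) := by
    intro u hu
    have h1 := hWH u hu
    have h2 := dg_split (G := H) u (subset_univ F)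
    have h3 := hf2 u
    have h4 := eb_mono_graph hHG {u} (univ \ F)
    simp only [eb, sum_singleton] at h4
    linarith
  have hco : ∀ z ∈ F, z ∉ F3 → z ∉ Ex → dg G z (univ \ F) ≤ 1 / 800000000 * N := by
    intro z hz hz3 hzE
    exact coarse (η := η) (ε5 := η) hcard hNpos (by rw [hηd]; norm_num) (by rw [hηd]; norm_num)
      hfar' hF3F hF3n hFn hf3 hf4 hWd hExd hExc hz hz3 hzE
  have hfin := finish hk hcyc hHG hN1 hcard hE hF3F hExF hExM hExc hf3 hf4 hco hExd hWW hw hWH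
  rw [← hW, ← hK] at hfin
  have h1 : (3 * (#W : ℝ)) ^ 2 ≤ (N + 8 * K) ^ 2 := pow_le_pow_left₀ (by positivity) hfin 2
  have h2 : K ^ 2 * 1 ≤ K ^ 2 * N := mul_le_mul_of_nonneg_left hN0 (by positivity)
  have h3 : 0 < K * N := by positivity
  have h4 : 0 < K ^ 2 * N := by positivity
  linarith
end EFR

namespace EFR
open Finset

lemma eb_univ {V : Type*} [Fintype V] (G : SimpleGraph V) :
    eb G univ univ = 2 * (G.edgeSet.ncard : ℝ) := by
  classical
  have h1 : ∀ v, dg G v univ = (G.degree v : ℝ) := by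
    intro v
    rw [dg_filter, ← card_neighborFinset_eq_degree]
    congr 2
    ext x; simp
  unfold eb
  simp_rw [h1]
  have h2 := G.sum_degrees_eq_twice_card_edges
  rw [Set.ncard_eq_toFinset_card', ← edgeFinset]
  exact_mod_cast h2

lemma dg_nat {V : Type*} [Fintype V] (G : SimpleGraph V) (v : V) :
    ∃ d : ℕ, dg G v univ = d := by
  classical
  exact ⟨_, dg_filter v univ⟩

lemma eb_comap {V : Type*} (G : SimpleGraph V) (W : Finset V) :
    eb (G.comap (Subtype.val : {x // x ∈ W} → V)) univ univ = eb G W W := by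
  unfold eb dg
  rw [← sum_coe_sort W]
  refine sum_congr rfl fun a _ => ?_
  rw [← sum_coe_sort W]
  rfl

lemma NoCyc_comap {V : Type*} {G H : SimpleGraph V} {m : ℕ} (h : NoCyc G H m) (W : Finset V) :
    NoCyc (G.comap (Subtype.val : {x // x ∈ W} → V)) (H.comap (Subtype.val : {x // x ∈ W} → V)) m := by
  intro e t z v hn hc hl hH hs hG
  refine h e.1 (t.map Subtype.val) z.1 v.1 ?_ ?_ (by simpa using hl) hH ?_ hG
  · rw [← List.map_cons]
    exact hn.map Subtype.val_injective
  · rw [← List.map_cons, List.isChain_map]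
    exact hc
  · have := hs.map Subtype.val
    simpa using this

lemma drop_arith {n e d : ℤ} (h : n ^ 2 < 4 * e) (hd : 2 * d ≤ n) : (n - 1) ^ 2 < 4 * (e - d) := by
  rcases Int.even_or_odd' n with ⟨m, rfl | rfl⟩
  · have : m ^ 2 < e := by linarith
    have : m ^ 2 + 1 ≤ e := this
    have : d ≤ m := by linarith
    linarith
  · have : 4 * (m ^ 2 + m) + 1 < 4 * e := by linarith
    have : m ^ 2 + m + 1 ≤ e := by omega
    have : d ≤ m := by omega
    linarith

theorem induct {k : ℕ} (hk : 3 ≤ k) : ∃ C : ℝ, 0 < C ∧ ∀ (n : ℕ) (V : Type) [Fintype V]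
    (G H : SimpleGraph V), Fintype.card V = n → H ≤ G → NoCyc G H (2 * k + 1) →
    (n : ℝ) ^ 2 / 2 < eb G univ univ → eb H univ univ ≤ (n : ℝ) ^ 2 / 18 + 2 * C * n := by
  obtain ⟨C1, M, N0, hC1, hM, hN0, hstep⟩ := one_step hk
  refine ⟨C1 + 80000 * M + N0, by positivity, ?_⟩
  set C := C1 + 80000 * M + N0 with hC
  have hC0 : 0 < C := by positivity
  intro n
  induction n using Nat.strong_induction_on with
  | _ n ih =>
  intro V _ G H hcard hHG hcyc hE
  classical
  have hcardR : (Fintype.card V : ℝ) = n := by exact_mod_cast hcard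
  have hn0 : (0 : ℝ) ≤ n := by positivity
  have key : ∀ W : Finset V, #W < n → (#W : ℝ) ^ 2 / 2 < eb G W W →
      eb H W W ≤ (#W : ℝ) ^ 2 / 18 + 2 * C * #W := by
    intro W hW h
    have := ih (#W) hW {x // x ∈ W} (G.comap Subtype.val) (H.comap Subtype.val) (by simp)
      (fun a b hab => hHG hab) (NoCyc_comap hcyc W) (by rw [eb_comap]; exact h)
    rwa [eb_comap] at this
  by_cases hsmall : (n : ℝ) < N0
  · have h1 := eb_le_card (G := H) univ univ
    rw [card_univ, hcardR] at h1
    have h2 : (n : ℝ) * n ≤ N0 * n := mul_le_mul_of_nonneg_right hsmall.le hn0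
    have h3 : N0 * n ≤ 2 * C * n := mul_le_mul_of_nonneg_right (by linarith) hn0
    linarith [sq_nonneg (n : ℝ)]
  push Not at hsmall
  have hn1 : (1 : ℝ) ≤ n := by linarith
  by_cases hv : ∃ v, dg G v univ ≤ n / 2 ∧ dg H v univ < n / 18
  · obtain ⟨v, hv1, hv2⟩ := hv
    have hn1' : 1 ≤ n := by exact_mod_cast hn1
    have hWc : #(univ \ {v} : Finset V) = n - 1 := by
      rw [card_sdiff_of_subset (subset_univ _), card_univ, hcard]; simp
    have hWr : (#(univ \ {v} : Finset V) : ℝ) = n - 1 := by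
      rw [hWc, Nat.cast_sub hn1']; simp
    have hsp : ∀ G' : SimpleGraph V, eb G' univ univ =
        eb G' (univ \ {v}) (univ \ {v}) + 2 * dg G' v univ := by
      intro G'
      have h1 := eb_split (G := G') (subset_univ {v})
      have h2 : eb G' {v} {v} = 0 := by simp [eb, dg, ad]
      have h3 : eb G' {v} (univ \ {v}) = dg G' v univ := by
        simp only [eb, sum_singleton]
        rw [dg_split (G := G') v (subset_univ {v})]
        simp [dg, ad]
      linarith
    have hIH := key (univ \ {v}) (by rw [hWc]; omega) (by
      have h1 := hsp G
      rw [hWr]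
      obtain ⟨d, hd⟩ := dg_nat G v
      rw [eb_univ, hd] at h1
      rw [eb_univ] at hE
      rw [hd] at hv1
      have h2 := drop_arith (n := n) (e := G.edgeSet.ncard) (d := d)
        (by
          have : (n : ℝ) ^ 2 < 4 * (G.edgeSet.ncard : ℝ) := by linarith
          exact_mod_cast this)
        (by
          have : 2 * (d : ℝ) ≤ n := by linarith
          exact_mod_cast this)
      have h3 : ((n : ℝ) - 1) ^ 2 < 4 * ((G.edgeSet.ncard : ℝ) - d) := by exact_mod_cast h2
      linarith)
    rw [hWr] at hIH
    have := hsp H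
    have : 1 ≤ C := by linarith
    linarith
  · push Not at hv
    rcases hstep V G H n hHG hcyc hcardR hsmall hE hv with h | ⟨W, hW1, hW2, hW3⟩
    · have : C1 * n ≤ 2 * C * n := mul_le_mul_of_nonneg_right (by linarith) hn0
      linarith
    · have h1 := key W (by
        have : (#W : ℝ) < n := by linarith
        exact_mod_cast this) hW2
      have hWn : (#W : ℝ) ≤ n := by linarith
      have h2 : (#W : ℝ) ^ 2 ≤ (n : ℝ) ^ 2 := pow_le_pow_left₀ (by positivity) hWn 2
      have h3 : 2 * C * #W ≤ 2 * C * ((1 - 1 / 80000) * n) :=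
        mul_le_mul_of_nonneg_left hW1 (by positivity)
      have h4 : 80000 * M * n ≤ C * n := mul_le_mul_of_nonneg_right (by linarith) hn0
      linarith

theorem final (k : ℕ) (hk : 3 ≤ k) : ∃ C : ℝ, 0 < C ∧ ∀ n : ℕ, 0 < n → ∀ G : SimpleGraph (Fin n),
    G.edgeSet.ncard = n ^ 2 / 4 + 1 →
    (2 / 9 : ℝ) * (n : ℝ) ^ 2 - C * (n : ℝ) ≤ (countEdgesInC G (2 * k + 1) : ℝ) := by
  obtain ⟨C, hC, hind⟩ := induct hk
  refine ⟨C, hC, ?_⟩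
  intro n _ G hG
  let H : SimpleGraph (Fin n) :=
    { Adj := fun a b => G.Adj a b ∧ ¬ occursInC G (2 * k + 1) s(a, b)
      symm := ⟨fun a b h => ⟨h.1.symm, by rw [Sym2.eq_swap]; exact h.2⟩⟩
      loopless := ⟨fun a h => G.irrefl h.1⟩ }
  have hHG : H ≤ G := fun a b h => h.1
  have hHs : H.edgeSet = {e | e ∈ G.edgeSet ∧ ¬ occursInC G (2 * k + 1) e} := by
    ext e
    induction e with
    | _ a b => exact Iff.rfl
  have hcyc : NoCyc G H (2 * k + 1) := by
    intro e t z v hn hc hl hH hs ha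
    exact hH.2 (occurs_of_list hn hc hl (by omega) hs ha)
  have hsum : countEdgesInC G (2 * k + 1) + H.edgeSet.ncard = G.edgeSet.ncard := by
    rw [hHs, countEdgesInC, ← Set.ncard_union_eq ?_ (Set.toFinite _) (Set.toFinite _)]
    · congr 1
      ext e
      simp only [Set.mem_union, Set.mem_ofPred_eq]
      tauto
    · rw [Set.disjoint_left]
      intro e h1 h2
      exact h2.2 h1.2
  have hsumR : (countEdgesInC G (2 * k + 1) : ℝ) + H.edgeSet.ncard = G.edgeSet.ncard := by
    exact_mod_cast hsum
  have hfl : (n : ℝ) ^ 2 < 4 * (G.edgeSet.ncard : ℝ) := by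
    rw [hG]
    have : n ^ 2 < 4 * (n ^ 2 / 4 + 1) := by omega
    exact_mod_cast this
  have h1 := hind n (Fin n) G H (by simp) hHG hcyc (by rw [eb_univ]; linarith)
  rw [eb_univ] at h1
  linarith
end EFR

theorem stmt1 :
    ∀ k : ℕ, 3 ≤ k → ∃ C : ℝ, 0 < C ∧ ∀ n : ℕ, 0 < n → ∀ G : SimpleGraph (Fin n),
      G.edgeSet.ncard = n ^ 2 / 4 + 1 →
      (2 / 9 : ℝ) * (n : ℝ) ^ 2 - C * (n : ℝ)
        ≤ (countEdgesInC G (2 * k + 1) : ℝ) := by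
  intro k hk
  exact EFR.final k hk
end
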